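/- arXiv:2110.10856 — 5 statements merged into one kernel-verified Lean document; each statement's English description precedes it below -/
import Mathlib

section
/- Let k, m ≥ 0 with k + m ≤ n and let Z be a real n×(k+m) matrix. Then the following are equivalent: (a) for every rank-k k×n real matrix C representing a point of Gr≥0_{k,n}, the matrix CZ has rank k (i.e., the amplituhedron map Z̃ is well defined); (b) var(v) ≥ k for every nonzero v ∈ ℝ^n with v^T Z = 0. -/
noncomputable section

/-- The Pluecker coordinate of the full-rank `k x n` matrix `C` on the column set `S`
(the minor on the columns in `S`, taken in increasing order). -/
def pluck {k n : ℕ} (C : Matrix (Fin k) (Fin n) ℝ) (S : Finset (Fin n))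
    (h : S.card = k) : ℝ :=
  (C.submatrix id (fun t => ((S.orderIsoOfFin h) t).val)).det

/-- `signChanges v` is `var(v)`: the number of sign changes in the sequence
`v 0, ..., v (n-1)`, ignoring zero entries. -/
def signChanges {n : ℕ} (v : Fin n → ℝ) : ℕ :=
  sSup {m | ∃ f : Fin (m + 1) → Fin n, StrictMono f ∧
    ∀ j : Fin m, v (f j.castSucc) * v (f j.succ) < 0}

open Matrix in
theorem factorial_mul_det_mul {R : Type*} [CommRing R] {k n : ℕ}
    (A : Matrix (Fin k) (Fin n) R) (B : Matrix (Fin n) (Fin k) R) :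
    (k.factorial : R) * (A * B).det =
      ∑ p : Fin k → Fin n, (A.submatrix id p).det * (B.submatrix p id).det := by
  have expand : (A * B).det =
      ∑ p : Fin k → Fin n, (A.submatrix id p).det * ∏ i, B (p i) i := by
    simp only [det_apply', mul_apply, Finset.prod_univ_sum, Finset.mul_sum,
      Fintype.piFinset_univ, Finset.sum_mul]
    rw [Finset.sum_comm]
    simp [Finset.prod_mul_distrib, mul_assoc]
  have twist (τ : Equiv.Perm (Fin k)) : (A * B).det =
      ∑ p : Fin k → Fin n, (A.submatrix id p).det *
        ((Equiv.Perm.sign τ : ℤ) * ∏ i, B (p (τ i)) i) := by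
    rw [expand, ← (Equiv.arrowCongr τ (Equiv.refl (Fin n))).symm.sum_comp]
    refine Finset.sum_congr rfl fun p _ => ?_
    have h := det_permute' τ (A.submatrix id p)
    rw [submatrix_submatrix] at h
    have e : ((Equiv.arrowCongr τ (Equiv.refl (Fin n))).symm p) = p ∘ τ := by
      ext; simp [Equiv.arrowCongr]
    rw [e]
    simp only [Function.comp_apply]
    rw [show (A.submatrix id (p ∘ τ)).det = _ from h]
    ring
  calc (k.factorial : R) * (A * B).det = ∑ _ : Equiv.Perm (Fin k), (A * B).det := by
        simp [Fintype.card_perm]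
    _ = ∑ τ : Equiv.Perm (Fin k), ∑ p : Fin k → Fin n, (A.submatrix id p).det *
        ((Equiv.Perm.sign τ : ℤ) * ∏ i, B (p (τ i)) i) :=
      Finset.sum_congr rfl fun τ _ => twist τ
    _ = _ := by
      rw [Finset.sum_comm]
      refine Finset.sum_congr rfl fun p _ => ?_
      rw [← Finset.mul_sum, det_apply' (B.submatrix p id)]
      simp

open Matrix in
theorem det_submatrix_mul_det_submatrix_eq {R : Type*} [CommRing R] {k n : ℕ}
    (A : Matrix (Fin k) (Fin n) R) (B : Matrix (Fin n) (Fin k) R) {p : Fin k → Fin n}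
    (hp : Function.Injective p) :
    ∃ s : Fin k → Fin n, StrictMono s ∧
      (A.submatrix id p).det * (B.submatrix p id).det =
        (A.submatrix id s).det * (B.submatrix s id).det ∧
      ((A.submatrix id p).det ≠ 0 → (A.submatrix id s).det ≠ 0) := by
  set τ := Tuple.sort p
  have hs : StrictMono (p ∘ τ) :=
    (Tuple.monotone_sort p).strictMono_of_injective (hp.comp τ.injective)
  have hA := det_permute' τ (A.submatrix id p)
  have hB := det_permute τ (B.submatrix p id)
  rw [submatrix_submatrix] at hA hB
  change (A.submatrix id (p ∘ τ)).det = _ at hA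
  change (B.submatrix (p ∘ τ) id).det = _ at hB
  refine ⟨p ∘ τ, hs, ?_, fun h => ?_⟩
  · rw [hA, hB, mul_mul_mul_comm, ← Int.cast_mul, ← Units.val_mul, Int.units_mul_self]
    simp
  · rw [hA]
    rcases Int.units_eq_one_or (Equiv.Perm.sign τ) with hτ | hτ <;> simpa [hτ] using h

/-- The matrix with entries `q ^ (i - j) ^ 2`. -/
def gaussianMatrix (n : ℕ) (q : ℝ) : Matrix (Fin n) (Fin n) ℝ :=
  Matrix.of fun i j => q ^ (((i : ℤ) - (j : ℤ)) ^ 2).toNat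

theorem gaussianMatrix_zero (n : ℕ) : gaussianMatrix n 0 = 1 := by
  ext i j
  rw [gaussianMatrix, Matrix.of_apply, Matrix.one_apply]
  split_ifs with h
  · simp [h]
  · refine zero_pow ?_
    have : ((i : ℤ) - j) ≠ 0 := by
      intro h'; apply h; ext; omega
    have := pow_pos (abs_pos.2 this) 2
    rw [sq_abs] at this
    omega

theorem continuous_gaussianMatrix (n : ℕ) : Continuous (gaussianMatrix n) := by
  unfold gaussianMatrix
  refine continuous_matrix fun i j => ?_
  simp only [Matrix.of_apply]
  fun_prop

theorem sum_sq_sub_lt_of_ne_one {k n : ℕ} {s t : Fin k → Fin n} (hs : StrictMono s)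
    (ht : StrictMono t) {σ : Equiv.Perm (Fin k)} (hσ : σ ≠ 1) :
    ∑ i, ((s i : ℤ) - t i) ^ 2 < ∑ i, ((s (σ i) : ℤ) - t i) ^ 2 := by
  have hst : Monovary (fun i => (s i : ℤ)) (fun i => (t i : ℤ)) := by
    intro i j hij
    have : t i < t j := by simpa using hij
    have := hs.monotone (ht.lt_iff_lt.1 this).le
    simpa using this
  have hlt : ∑ i, (s (σ i) : ℤ) * t i < ∑ i, (s i : ℤ) * t i := by
    refine (hst.sum_comp_perm_mul_lt_sum_mul_iff (σ := σ)).2 fun h => hσ ?_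
    have hmono : Monotone σ := by
      intro i j hij
      rcases hij.eq_or_lt with rfl | hij
      · rfl
      · have : (t i : ℤ) < t j := by exact_mod_cast ht hij
        have := h this
        simp only [Function.comp_apply, Nat.cast_le, Fin.val_fin_le] at this
        exact hs.le_iff_le.1 this
    have := (hmono.strictMono_of_injective σ.injective)
    ext i
    have h' : (σ : Fin k → Fin k) = id :=
      (this.range_inj strictMono_id).1 (by simp [σ.surjective.range_eq])
    simp [h']
  have hsq : ∑ i, (s (σ i) : ℤ) ^ 2 = ∑ i, (s i : ℤ) ^ 2 :=
    Equiv.sum_comp σ fun i => (s i : ℤ) ^ 2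
  simp only [sub_sq, Finset.sum_add_distrib, Finset.sum_sub_distrib, mul_assoc,
    ← Finset.mul_sum]
  linarith

open Filter Topology in
theorem eventually_det_gaussianMatrix_pos {k n : ℕ} {s t : Fin k → Fin n} (hs : StrictMono s)
    (ht : StrictMono t) :
    ∀ᶠ q in 𝓝[>] (0 : ℝ), 0 < ((gaussianMatrix n q).submatrix s t).det := by
  set E : Equiv.Perm (Fin k) → ℕ := fun σ => ∑ i, (((s (σ i) : ℤ) - t i) ^ 2).toNat with hE
  have hEσ (σ : Equiv.Perm (Fin k)) (hσ : σ ≠ 1) : E 1 < E σ := by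
    have := sum_sq_sub_lt_of_ne_one hs ht hσ
    zify
    simpa [hE, sq_nonneg] using this
  have hle (σ : Equiv.Perm (Fin k)) : E 1 ≤ E σ := by
    by_cases h : σ = 1
    · rw [h]
    · exact (hEσ σ h).le
  set h : ℝ → ℝ := fun q =>
    ∑ σ : Equiv.Perm (Fin k), ((Equiv.Perm.sign σ : ℤ) : ℝ) * q ^ (E σ - E 1)
  have hcont : Continuous h := by fun_prop
  have h0 : h 0 = 1 := by
    simp only [h]
    rw [Finset.sum_eq_single 1]
    · simp
    · intro σ _ hσ
      rw [zero_pow (Nat.sub_ne_zero_of_lt (hEσ σ hσ)), mul_zero]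
    · simp
  have hpos : ∀ᶠ q in 𝓝[>] (0 : ℝ), 0 < h q :=
    (hcont.tendsto 0).eventually (lt_mem_nhds (h0 ▸ one_pos)) |>.filter_mono nhdsWithin_le_nhds
  filter_upwards [hpos, self_mem_nhdsWithin] with q hq hq0
  have : ((gaussianMatrix n q).submatrix s t).det = q ^ E 1 * h q := by
    rw [Matrix.det_apply', Finset.mul_sum]
    refine Finset.sum_congr rfl fun σ _ => ?_
    rw [mul_left_comm, ← pow_add, Nat.add_sub_cancel' (hle σ)]
    simp [gaussianMatrix, hE, Finset.prod_pow_eq_pow_sum]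
  rw [this]
  exact mul_pos (pow_pos hq0 _) hq

open Matrix in
theorem exists_det_submatrix_ne_zero {k n : ℕ} {C : Matrix (Fin k) (Fin n) ℝ}
    (hC : LinearIndependent ℝ C.row) : ∃ p : Fin k → Fin n, (C.submatrix id p).det ≠ 0 := by
  by_contra! h
  have hdet : (C * Cᵀ).det = 0 := by
    have := factorial_mul_det_mul C Cᵀ
    simpa [h, Nat.factorial_ne_zero] using this
  obtain ⟨w, hw, hw0⟩ := exists_vecMul_eq_zero_iff.2 hdet
  have hz : (w ᵥ* C) ⬝ᵥ (w ᵥ* C) = 0 := by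
    have h2 : w ᵥ* (C * Cᵀ) ⬝ᵥ w = 0 := by rw [hw0, zero_dotProduct]
    rwa [← vecMul_vecMul, ← dotProduct_mulVec, mulVec_transpose] at h2
  have hwC : w ᵥ* C = 0 ᵥ* C := by rw [zero_vecMul, dotProduct_self_eq_zero.1 hz]
  exact hw (vecMul_injective_iff.2 hC hwC)

open Matrix in
/-- Right multiplication by a matrix all of whose maximal minors are positive turns a totally
nonnegative full-rank matrix into a totally positive one. -/
theorem det_submatrix_mul_pos {k n : ℕ} {C : Matrix (Fin k) (Fin n) ℝ}
    (hC : LinearIndependent ℝ C.row) {ε : ℝ} (hε : ε ≠ 0)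
    (hnonneg : ∀ s : Fin k → Fin n, StrictMono s → 0 ≤ ε * (C.submatrix id s).det)
    {G : Matrix (Fin n) (Fin n) ℝ} {t : Fin k → Fin n}
    (hG : ∀ s : Fin k → Fin n, StrictMono s → 0 < (G.submatrix s t).det) :
    0 < ε * ((C * G).submatrix id t).det := by
  have hsum := factorial_mul_det_mul C (G.submatrix id t)
  have hterm (p : Fin k → Fin n) : 0 ≤ ε * ((C.submatrix id p).det *
      ((G.submatrix id t).submatrix p id).det) ∧ ((C.submatrix id p).det ≠ 0 →
      0 < ε * ((C.submatrix id p).det * ((G.submatrix id t).submatrix p id).det)) := by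
    by_cases hp : Function.Injective p
    · obtain ⟨s, hs, heq, hne⟩ := det_submatrix_mul_det_submatrix_eq C (G.submatrix id t) hp
      rw [heq, ← mul_assoc]
      exact ⟨mul_nonneg (hnonneg s hs) (hG s hs).le, fun h =>
        mul_pos ((hnonneg s hs).lt_of_ne' (mul_ne_zero hε (hne h))) (hG s hs)⟩
    · have h0 : (C.submatrix id p).det = 0 := by
        obtain ⟨i, j, hij, hne⟩ : ∃ i j, p i = p j ∧ i ≠ j := by
          simpa [Function.Injective] using hp
        exact det_zero_of_column_eq hne fun l => by simp [hij]
      simp [h0]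
  have hpos : 0 < ∑ p : Fin k → Fin n, ε * ((C.submatrix id p).det *
      ((G.submatrix id t).submatrix p id).det) := by
    obtain ⟨p, hp⟩ := exists_det_submatrix_ne_zero hC
    exact Finset.sum_pos' (fun p _ => (hterm p).1) ⟨p, Finset.mem_univ _, (hterm p).2 hp⟩
  rw [← Finset.mul_sum, ← hsum, mul_left_comm] at hpos
  exact pos_of_mul_pos_right hpos (Nat.cast_nonneg _)

theorem alternating_sign {k : ℕ} {u : Fin (k + 1) → ℝ}
    (hu : ∀ j : Fin k, u j.castSucc * u j.succ < 0) (h0 : u 0 ≠ 0) (j : Fin (k + 1)) :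
    0 < u 0 * ((-1) ^ (j : ℕ) * u j) := by
  induction j using Fin.induction with
  | zero => simpa using mul_self_pos.2 h0
  | succ j ih =>
    have h := mul_pos_of_neg_of_neg (hu j) (neg_lt_zero.2 ih)
    have hj : u j.castSucc ≠ 0 := left_ne_zero_of_mul (hu j).ne
    have e : u j.castSucc * u j.succ * -(u 0 * ((-1) ^ (j.castSucc : ℕ) * u j.castSucc)) =
        (u j.castSucc * u j.castSucc) * (u 0 * ((-1) ^ (j.succ : ℕ) * u j.succ)) := by
      rw [Fin.val_succ, Fin.val_castSucc, pow_succ]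
      ring
    rw [e] at h
    exact pos_of_mul_pos_right h (mul_self_nonneg _)

open Matrix Filter Topology in
/-- Gantmakher and Krein: a vector in the row span of a totally nonnegative full-rank `k × n` matrix
does not have `k` sign changes. -/
theorem not_alternating_vecMul {k n : ℕ} {C : Matrix (Fin k) (Fin n) ℝ}
    (hC : LinearIndependent ℝ C.row) {ε : ℝ} (hε : ε ≠ 0)
    (hnonneg : ∀ s : Fin k → Fin n, StrictMono s → 0 ≤ ε * (C.submatrix id s).det)
    (hk : 0 < k) (c : Fin k → ℝ) {f : Fin (k + 1) → Fin n} (hf : StrictMono f) :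
    ¬ ∀ j : Fin k, (c ᵥ* C) (f j.castSucc) * (c ᵥ* C) (f j.succ) < 0 := by
  intro halt
  have h0 : (c ᵥ* C) (f 0) ≠ 0 := left_ne_zero_of_mul (halt ⟨0, hk⟩).ne
  have hlim : Tendsto (fun q => c ᵥ* (C * gaussianMatrix n q)) (𝓝[>] 0) (𝓝 (c ᵥ* C)) := by
    have hcont : Continuous fun q => c ᵥ* (C * gaussianMatrix n q) :=
      continuous_const.matrix_vecMul (continuous_const.matrix_mul (continuous_gaussianMatrix n))
    have := (hcont.tendsto 0).mono_left (nhdsWithin_le_nhds (s := Set.Ioi 0))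
    simpa [gaussianMatrix_zero] using this
  have hlim' (i : Fin n) := tendsto_pi_nhds.1 hlim i
  have halt' : ∀ᶠ q in 𝓝[>] (0 : ℝ), ∀ j : Fin k,
      (c ᵥ* (C * gaussianMatrix n q)) (f j.castSucc) *
        (c ᵥ* (C * gaussianMatrix n q)) (f j.succ) < 0 :=
    eventually_all.2 fun j => ((hlim' _).mul (hlim' _)).eventually (gt_mem_nhds (halt j))
  have hne' : ∀ᶠ q in 𝓝[>] (0 : ℝ), (c ᵥ* (C * gaussianMatrix n q)) (f 0) ≠ 0 :=
    (hlim' _).eventually_ne h0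
  have hpos : ∀ᶠ q in 𝓝[>] (0 : ℝ), ∀ s t : Fin k → Fin n, StrictMono s → StrictMono t →
      0 < ((gaussianMatrix n q).submatrix s t).det :=
    eventually_all.2 fun s => eventually_all.2 fun t => eventually_imp_distrib_left.2 fun hs =>
      eventually_imp_distrib_left.2 fun ht => eventually_det_gaussianMatrix_pos hs ht
  obtain ⟨q, hq1, hq2, hq3⟩ := (halt'.and (hne'.and hpos)).exists
  set D := C * gaussianMatrix n q
  set v := c ᵥ* D
  have hD (t : Fin k → Fin n) (ht : StrictMono t) : 0 < ε * (D.submatrix id t).det :=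
    det_submatrix_mul_pos hC hε hnonneg fun s hs => hq3 s t hs ht
  let M : Matrix (Fin (k + 1)) (Fin (k + 1)) ℝ :=
    of (Fin.cons (fun j => v (f j)) fun i j => D i (f j))
  have hM : M.det = 0 := by
    refine exists_vecMul_eq_zero_iff.1 ⟨Fin.cons 1 (-c), fun h => ?_, ?_⟩
    · simpa using congr_fun h 0
    · ext j
      simp [vecMul, dotProduct, Fin.sum_univ_succ, M, v]
  rw [det_succ_row_zero] at hM
  have hsum : 0 < ∑ j : Fin (k + 1), v (f 0) * ((-1) ^ (j : ℕ) * v (f j)) *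
      (ε * (D.submatrix id (f ∘ j.succAbove)).det) :=
    Finset.sum_pos (fun j _ => mul_pos (alternating_sign (u := fun j => v (f j)) hq1 hq2 j)
      (hD _ (hf.comp (Fin.strictMono_succAbove j)))) Finset.univ_nonempty
  have heq : ∑ j : Fin (k + 1), v (f 0) * ((-1) ^ (j : ℕ) * v (f j)) *
      (ε * (D.submatrix id (f ∘ j.succAbove)).det) = v (f 0) * ε * 0 := by
    rw [← hM, Finset.mul_sum]
    refine Finset.sum_congr rfl fun j _ => ?_
    have : M.submatrix Fin.succ j.succAbove = D.submatrix id (f ∘ j.succAbove) := by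
      ext a b; simp [M]
    rw [this]
    simp only [M, of_apply, Fin.cons_zero]
    ring
  rw [heq, mul_zero] at hsum
  exact lt_irrefl _ hsum

theorem bddAbove_signChanges {n : ℕ} (v : Fin n → ℝ) :
    BddAbove {m | ∃ f : Fin (m + 1) → Fin n, StrictMono f ∧
      ∀ j : Fin m, v (f j.castSucc) * v (f j.succ) < 0} := by
  refine ⟨n, ?_⟩
  rintro m ⟨f, hf, -⟩
  have := Fintype.card_le_of_injective f hf.injective
  simp only [Fintype.card_fin] at this
  omega

theorem exists_alternating_of_le_signChanges {k n : ℕ} {v : Fin n → ℝ} (hv : v ≠ 0)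
    (hk : k ≤ signChanges v) :
    ∃ f : Fin (k + 1) → Fin n, StrictMono f ∧
      ∀ j : Fin k, v (f j.castSucc) * v (f j.succ) < 0 := by
  obtain ⟨i, -⟩ := Function.ne_iff.1 hv
  obtain ⟨f, hf, hlt⟩ := Nat.sSup_mem (s := {m | ∃ f : Fin (m + 1) → Fin n, StrictMono f ∧
      ∀ j : Fin m, v (f j.castSucc) * v (f j.succ) < 0})
    ⟨0, fun _ => i, fun a b hab => absurd hab (Subsingleton.elim (α := Fin 1) a b).not_lt,
      fun j => j.elim0⟩ (bddAbove_signChanges v)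
  exact ⟨f ∘ Fin.castLE (Nat.succ_le_succ hk), hf.comp (Fin.strictMono_castLE _),
    fun j => hlt (Fin.castLE hk j)⟩

/-- The positions of nonzero entries whose preceding nonzero entry has the opposite sign. -/
def signChangeSet {n : ℕ} (v : Fin n → ℝ) : Finset (Fin n) :=
  open Classical in
  Finset.univ.filter fun i => ∃ p < i, v p * v i < 0 ∧ ∀ l, p < l → l < i → v l = 0

theorem exists_mem_signChangeSet {n : ℕ} {v : Fin n → ℝ} {i j : Fin n} (hij : i < j)
    (hv : v i * v j < 0) : ∃ d ∈ signChangeSet v, i < d ∧ d ≤ j := by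
  classical
  obtain ⟨d, hd, hmin⟩ := ({d | i < d ∧ d ≤ j ∧ v i * v d < 0} : Finset (Fin n)).exists_minimal
    ⟨j, by simp [hij, hv]⟩
  simp only [Finset.mem_filter, Finset.mem_univ, true_and] at hd hmin
  have hvi : v i ≠ 0 := left_ne_zero_of_mul hv.ne
  obtain ⟨p, hp, hmax⟩ := ({p | i ≤ p ∧ p < d ∧ v p ≠ 0} : Finset (Fin n)).exists_maximal
    ⟨i, by simp [hd.1, hvi]⟩
  simp only [Finset.mem_filter, Finset.mem_univ, true_and] at hp hmax
  refine ⟨d, ?_, hd.1, hd.2.1⟩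
  simp only [signChangeSet, Finset.mem_filter, Finset.mem_univ, true_and]
  refine ⟨p, hp.2.1, ?_, fun l hl hld => ?_⟩
  · have hpos : 0 < v i * v p := by
      refine lt_of_le_of_ne ?_ (mul_ne_zero hvi hp.2.2).symm
      by_contra! hneg
      have hip : i < p := lt_of_le_of_ne hp.1 (by
        rintro rfl; exact absurd hneg (mul_self_nonneg _).not_gt)
      exact absurd (hmin ⟨hip, hp.2.1.le.trans hd.2.1, hneg⟩ hp.2.1.le) hp.2.1.not_ge
    have h := mul_neg_of_pos_of_neg hpos hd.2.2
    rw [show v i * v p * (v i * v d) = (v i * v i) * (v p * v d) by ring] at h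
    exact neg_of_mul_neg_right h (mul_self_nonneg _)
  · by_contra hvl
    exact absurd (hmax ⟨hp.1.trans hl.le, hld, hvl⟩ hl.le) hl.not_ge

theorem card_signChangeSet_le {n : ℕ} (v : Fin n → ℝ) :
    (signChangeSet v).card ≤ signChanges v := by
  classical
  rcases hm : (signChangeSet v).card with _ | m
  · exact Nat.zero_le _
  refine le_csSup (bddAbove_signChanges v) ?_
  set e := (signChangeSet v).orderEmbOfFin hm
  have he (t : Fin (m + 1)) :
      ∃ p < e t, v p * v (e t) < 0 ∧ ∀ l, p < l → l < e t → v l = 0 := by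
    exact (Finset.mem_filter.1 ((signChangeSet v).orderEmbOfFin_mem hm t)).2
  obtain ⟨p, hp, hpv, -⟩ := he 0
  refine ⟨Fin.cons p e, Fin.strictMono_iff_lt_succ.2 fun t => ?_, fun t => ?_⟩
  · induction t using Fin.cases with
    | zero => simpa using hp
    | succ t => simp
  · induction t using Fin.cases with
    | zero => simpa using hpv
    | succ t =>
      rw [← Fin.succ_castSucc, Fin.cons_succ, Fin.cons_succ]
      obtain ⟨r, hr, hrv, hzero⟩ := he t.succ
      have hlt : e t.castSucc < e t.succ := e.strictMono t.castSucc_lt_succ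
      obtain ⟨_, _, hne, -⟩ := he t.castSucc
      have hv0 : v (e t.castSucc) ≠ 0 := right_ne_zero_of_mul hne.ne
      have hle : e t.castSucc ≤ r := by
        by_contra! h
        exact hv0 (hzero _ h hlt)
      have hpos : 0 < v (e t.castSucc) * v r := by
        refine lt_of_le_of_ne ?_ (mul_ne_zero hv0 (left_ne_zero_of_mul hrv.ne)).symm
        by_contra! hneg
        have hlt' : e t.castSucc < r := lt_of_le_of_ne hle (by
          intro h; rw [h] at hneg; exact absurd hneg (mul_self_nonneg _).not_gt)
        obtain ⟨d, hd, h1, h2⟩ := exists_mem_signChangeSet hlt' hneg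
        obtain ⟨s, rfl⟩ : ∃ s, e s = d := by
          have : d ∈ Set.range e := by
            rw [Finset.range_orderEmbOfFin]; exact hd
          exact this
        have h3 := e.lt_iff_lt.1 h1
        have h4 := e.lt_iff_lt.1 (h2.trans_lt hr)
        rw [Fin.lt_def] at h3 h4
        simp at h3 h4
        omega
      have h := mul_neg_of_pos_of_neg hpos hrv
      rw [show v (e t.castSucc) * v r * (v r * v (e t.succ)) =
        (v r * v r) * (v (e t.castSucc) * v (e t.succ)) by ring] at h
      exact neg_of_mul_neg_right h (mul_self_nonneg _)

theorem exists_monotone_surjective_of_signChanges_lt {k n : ℕ} (hkn : k ≤ n) {v : Fin n → ℝ}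
    (hv : signChanges v < k) :
    ∃ β : Fin n → Fin k, Monotone β ∧ Function.Surjective β ∧
      ∀ i j, β i = β j → 0 ≤ v i * v j := by
  classical
  have hk : 0 < k := (Nat.zero_le _).trans_lt hv
  have hn : 0 < n := hk.trans_le hkn
  obtain ⟨D, hsub, hD⟩ := Finset.exists_superset_card_eq
    (s := insert (⟨0, hn⟩ : Fin n) (signChangeSet v)) (n := k)
    ((Finset.card_insert_le _ _).trans ((card_signChangeSet_le v).trans_lt hv)) (by simpa using hkn)
  rw [Finset.insert_subset_iff] at hsub
  set e := D.orderEmbOfFin hD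
  have hrange (d : Fin n) (hd : d ∈ D) : ∃ b, e b = d := by
    have : d ∈ Set.range e := by
      rw [Finset.range_orderEmbOfFin]; exact hd
    exact this
  have hmax (i : Fin n) : ∃ b, e b ≤ i ∧ ∀ b', e b' ≤ i → b' ≤ b := by
    obtain ⟨b₀, hb₀⟩ := hrange _ hsub.1
    obtain ⟨b, hb, hle⟩ := ({b | e b ≤ i} : Finset (Fin k)).exists_max_image id
      ⟨b₀, Finset.mem_filter.2 ⟨Finset.mem_univ _, hb₀.trans_le (Nat.zero_le _)⟩⟩
    exact ⟨b, by simpa using hb, fun b' hb' => hle b' (by simpa using hb')⟩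
  choose β hβ hβmax using hmax
  have hβe (b : Fin k) : β (e b) = b :=
    le_antisymm (e.le_iff_le.1 (hβ (e b))) (hβmax (e b) b le_rfl)
  have hsep {i j : Fin n} (hij : i < j) (hneg : v i * v j < 0) : β i < β j := by
    obtain ⟨d, hd, h1, h2⟩ := exists_mem_signChangeSet hij hneg
    obtain ⟨b, rfl⟩ := hrange d (hsub.2 hd)
    exact lt_of_lt_of_le (e.lt_iff_lt.1 (lt_of_le_of_lt (hβ i) h1)) (hβmax j b h2)
  refine ⟨β, fun i j hij => hβmax _ _ ((hβ i).trans hij), fun b => ⟨e b, hβe b⟩,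
    fun i j hij => ?_⟩
  by_contra! hneg
  rcases lt_trichotomy i j with h | rfl | h
  · exact (hsep h hneg).ne hij
  · exact absurd hneg (mul_self_nonneg _).not_gt
  · exact (hsep h (by rwa [mul_comm])).ne' hij

/-- The matrix whose `b`-th row is the restriction of `w` to the fiber of `β` over `b`. -/
def fiberMatrix {k n : ℕ} (β : Fin n → Fin k) (w : Fin n → ℝ) : Matrix (Fin k) (Fin n) ℝ :=
  Matrix.of fun b i => if β i = b then w i else 0

open Matrix in
theorem vecMul_fiberMatrix {k n : ℕ} (β : Fin n → Fin k) (w : Fin n → ℝ) (c : Fin k → ℝ)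
    (i : Fin n) : (c ᵥ* fiberMatrix β w) i = c (β i) * w i := by
  simp [fiberMatrix, vecMul, dotProduct]

theorem det_submatrix_fiberMatrix_nonneg {k n : ℕ} {β : Fin n → Fin k} (hβ : Monotone β)
    {w : Fin n → ℝ} (hw : ∀ i, 0 ≤ w i) {s : Fin k → Fin n} (hs : Monotone s) :
    0 ≤ ((fiberMatrix β w).submatrix id s).det := by
  by_cases hsurj : Function.Surjective (β ∘ s)
  · have hid : β ∘ s = id :=
      (((hβ.comp hs).strictMono_of_injective (Finite.injective_iff_surjective.2 hsurj)).range_inj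
        strictMono_id).1 (by simp [hsurj.range_eq])
    have hdiag : (fiberMatrix β w).submatrix id s = Matrix.diagonal fun j => w (s j) := by
      ext b j
      have : β (s j) = j := congr_fun hid j
      by_cases h : j = b
      · subst h
        simp [fiberMatrix, this]
      · simp [fiberMatrix, this, h, Matrix.diagonal_apply_ne' _ h]
    rw [hdiag, Matrix.det_diagonal]
    exact Finset.prod_nonneg fun j _ => hw _
  · obtain ⟨b, hb⟩ : ∃ b, ∀ j, β (s j) ≠ b := by
      simpa [Function.Surjective] using hsurj
    rw [Matrix.det_eq_zero_of_row_eq_zero b fun j => by simp [fiberMatrix, hb j]]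

open Matrix in
/-- Every vector with fewer than `k` sign changes lies in the row span of a totally nonnegative
full-rank `k × n` matrix. -/
theorem exists_totallyNonneg_vecMul_eq {k n : ℕ} (hkn : k ≤ n) {v : Fin n → ℝ}
    (hv : signChanges v < k) :
    ∃ (C : Matrix (Fin k) (Fin n) ℝ) (c : Fin k → ℝ), LinearIndependent ℝ C.row ∧
      (∀ s : Fin k → Fin n, StrictMono s → 0 ≤ (C.submatrix id s).det) ∧ c ᵥ* C = v := by
  obtain ⟨β, hmono, hsurj, hsign⟩ := exists_monotone_surjective_of_signChanges_lt hkn hv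
  have hrep (b : Fin k) : ∃ i, β i = b ∧ (v i = 0 → ∀ j, β j = b → v j = 0) := by
    by_cases h : ∃ i, β i = b ∧ v i ≠ 0
    · obtain ⟨i, hi, hvi⟩ := h
      exact ⟨i, hi, fun h0 => absurd h0 hvi⟩
    · push Not at h
      obtain ⟨i, hi⟩ := hsurj b
      exact ⟨i, hi, fun _ => h⟩
  choose r hr hr0 using hrep
  set w : Fin n → ℝ := fun i => if v (r (β i)) = 0 then 1 else v i / v (r (β i)) with hw
  have hwr (b : Fin k) : w (r b) = 1 := by
    simp only [hw, hr]
    split_ifs with h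
    · rfl
    · exact div_self h
  refine ⟨fiberMatrix β w, fun b => v (r b), vecMul_injective_iff.1 fun x y hxy => ?_,
    fun s hs => det_submatrix_fiberMatrix_nonneg hmono (fun i => ?_) hs.monotone, ?_⟩
  · ext b
    have := congr_fun hxy (r b)
    simpa [vecMul_fiberMatrix, hr, hwr] using this
  · simp only [hw]
    split_ifs with h
    · exact zero_le_one
    · rw [← mul_div_mul_right _ _ h]
      exact div_nonneg (hsign _ _ (hr _).symm) (mul_self_nonneg _)
  · ext i
    rw [vecMul_fiberMatrix]
    simp only [hw]
    split_ifs with h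
    · rw [h, zero_mul, hr0 _ h i rfl]
    · exact mul_div_cancel₀ _ h

theorem pluck_eq_det_submatrix {k n : ℕ} (C : Matrix (Fin k) (Fin n) ℝ) {s : Fin k → Fin n}
    {S : Finset (Fin n)} (h : S.card = k) (hs : StrictMono s) (hmem : ∀ t, s t ∈ S) :
    pluck C S h = (C.submatrix id s).det := by
  rw [Finset.orderEmbOfFin_unique h hmem hs]
  rfl

/-- Karp: the amplituhedron map is well defined (i.e. `C * Z` has rank `k` for
every full-rank `C` representing a totally nonnegative point) if and only if
`var(v) ≥ k` for all nonzero `v` in the kernel of `Zᵀ`. -/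
theorem stmt4 (k m n : ℕ) (hkm : k + m ≤ n)
    (Z : Matrix (Fin n) (Fin (k + m)) ℝ) :
    (∀ C : Matrix (Fin k) (Fin n) ℝ,
        LinearIndependent ℝ (fun i => C i) →
        (∃ ε : ℝ, (ε = 1 ∨ ε = -1) ∧
          ∀ (S : Finset (Fin n)) (h : S.card = k), 0 ≤ ε * pluck C S h) →
        (C * Z).rank = k) ↔
    (∀ v : Fin n → ℝ, v ≠ 0 → Matrix.vecMul v Z = 0 → k ≤ signChanges v) := by
  have row_iff (A : Matrix (Fin k) (Fin (k + m)) ℝ) :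
      A.rank = k ↔ LinearIndependent ℝ A.row := by
    rw [Matrix.rank_eq_finrank_span_row, linearIndependent_iff_card_eq_finrank_span,
      Fintype.card_fin, eq_comm, Set.finrank]
  constructor
  · intro ha v hv0 hvZ
    by_contra! hlt
    obtain ⟨C, c, hC, hnonneg, rfl⟩ := exists_totallyNonneg_vecMul_eq (by omega) hlt
    have hrank := ha C hC ⟨1, Or.inl rfl, fun S h => by
      rw [one_mul]
      exact hnonneg _ (S.orderEmbOfFin h).strictMono⟩
    rw [row_iff, ← Matrix.vecMul_injective_iff] at hrank
    rw [Matrix.vecMul_vecMul] at hvZ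
    have hc : c = 0 := hrank (by simpa using hvZ)
    simp [hc] at hv0
  · rintro hb C hC ⟨ε, hε, hnonneg⟩
    rw [row_iff, ← Matrix.vecMul_injective_iff,
      ← Matrix.coe_vecMulLinear, injective_iff_map_eq_zero]
    intro c hc
    by_contra hc0
    have hv0 : Matrix.vecMul c C ≠ 0 := fun h =>
      hc0 (Matrix.vecMul_injective_iff.2 hC (by simpa using h))
    have hvZ : Matrix.vecMul (Matrix.vecMul c C) Z = 0 := by
      simpa [Matrix.vecMul_vecMul] using hc
    obtain ⟨f, hf, halt⟩ := exists_alternating_of_le_signChanges hv0 (hb _ hv0 hvZ)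
    have hk : 0 < k := Nat.pos_of_ne_zero fun hk => by
      subst hk
      exact hc0 (Subsingleton.elim _ _)
    have hε0 : ε ≠ 0 := by rcases hε with rfl | rfl <;> norm_num
    refine not_alternating_vecMul hC hε0 (fun s hs => ?_) hk c hf halt
    have hcard : (Finset.univ.image s).card = k := by
      simp [Finset.card_image_of_injective _ hs.injective]
    rw [← pluck_eq_det_submatrix C hcard hs (by simp)]
    exact hnonneg _ hcard
end
end

section
/- Let C be a real k×n matrix and Z a real n×(k+m) matrix with rows Z_1,…,Z_n ∈ ℝ^{k+m}, and let i_1,…,i_m ∈ [n]. Then det(M) = Σ_{J={j_1<⋯<j_k}⊆[n]} p_J(C) · det(N_J), where M is the (k+m)×(k+m) matrix whose first k rows are the rows of CZ and whose last m rows are Z_{i_1},…,Z_{i_m}; N_J is the (k+m)×(k+m) matrix with rows Z_{j_1},…,Z_{j_k},Z_{i_1},…,Z_{i_m}; the sum is over all k-element subsets J of [n]; and p_J(C) is the k×k minor of C on the columns in J. -/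
noncomputable section

/-- Twistor-type determinant: the determinant of the square matrix whose first
`k` rows are the rows of `Y` and whose last `m` rows are `u 0, ..., u (m-1)`. -/
def twist {k m : ℕ} (Y : Matrix (Fin k) (Fin (k + m)) ℝ)
    (u : Fin m → Fin (k + m) → ℝ) : ℝ :=
  (Matrix.of (Fin.append (fun i => Y i) u)).det

/-- Updating the left block of `Fin.append`. -/
theorem Fin.append_update_left {α : Type*} {k m : ℕ} (w : Fin k → α) (u : Fin m → α)
    (i : Fin k) (x : α) :
    Fin.append (Function.update w i x) u =
      Function.update (Fin.append w u) (Fin.castAdd m i) x := by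
  ext j
  refine Fin.addCases (fun a => ?_) (fun b => ?_) j
  · by_cases h : a = i
    · subst h; simp
    · have hne : Fin.castAdd m a ≠ Fin.castAdd m i := by simpa using h
      simp [h, hne]
  · have hne : Fin.natAdd k b ≠ Fin.castAdd m i := by
      simp only [ne_eq, Fin.ext_iff, Fin.val_natAdd, Fin.val_castAdd]; omega
    simp [hne]

/-- Fixing the last `m` arguments of an alternating map in `k + m` arguments. -/
def AlternatingMap.fixRight {R M N : Type*} [CommRing R] [AddCommGroup M] [Module R M]
    [AddCommGroup N] [Module R N] {k m : ℕ} (f : M [⋀^Fin (k + m)]→ₗ[R] N) (u : Fin m → M) :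
    M [⋀^Fin k]→ₗ[R] N where
  toFun w := f (Fin.append w u)
  map_update_add' := by
    intro inst w i x y
    rw [Subsingleton.elim inst (instDecidableEqFin k)]
    simp only [Fin.append_update_left, f.map_update_add]
  map_update_smul' := by
    intro inst w i c x
    rw [Subsingleton.elim inst (instDecidableEqFin k)]
    simp only [Fin.append_update_left, f.map_update_smul]
  map_eq_zero_of_eq' w i j h hij :=
    f.map_eq_zero_of_eq _ (i := Fin.castAdd m i) (j := Fin.castAdd m j) (by simpa using h)
      (by simpa using hij)

/-- The functions with image a given `k`-element set `J` are the permutations of the increasing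
enumeration of `J`. -/
theorem sum_image_eq_sum_perm {ι N : Type*} [LinearOrder ι] [Fintype ι] [AddCommMonoid N] {k : ℕ}
    (J : Finset ι) (h : J.card = k) (g : (Fin k → ι) → N) :
    ∑ r : Fin k → ι with Function.Injective r ∧ Finset.univ.image r = J, g r =
      ∑ σ : Equiv.Perm (Fin k), g (fun i => J.orderIsoOfFin h (σ i)) := by
  symm
  refine Finset.sum_nbij (fun σ i => J.orderIsoOfFin h (σ i)) ?_ ?_ ?_ (fun _ _ => rfl)
  · intro σ _
    have hinj : Function.Injective fun i => (J.orderIsoOfFin h (σ i) : ι) :=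
      Subtype.val_injective.comp ((J.orderIsoOfFin h).injective.comp σ.injective)
    refine Finset.mem_filter.2 ⟨Finset.mem_univ _, hinj, Finset.eq_of_subset_of_card_le ?_ ?_⟩
    · intro x hx
      obtain ⟨i, -, rfl⟩ := Finset.mem_image.1 hx
      exact (J.orderIsoOfFin h (σ i)).2
    · rw [Finset.card_image_of_injective _ hinj, h, Finset.card_univ, Fintype.card_fin]
  · intro σ _ τ _ hst
    ext1 i
    exact (J.orderIsoOfFin h).injective (Subtype.ext (congrFun hst i))
  · intro r hr
    obtain ⟨-, hinj, himg⟩ := Finset.mem_filter.1 hr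
    have hmem (i : Fin k) : r i ∈ J := himg ▸ Finset.mem_image_of_mem r (Finset.mem_univ i)
    have hs : Function.Injective fun i => (J.orderIsoOfFin h).symm ⟨r i, hmem i⟩ := fun a b hab =>
      hinj (congrArg Subtype.val ((J.orderIsoOfFin h).symm.injective hab))
    exact ⟨Equiv.ofBijective _ (Finite.injective_iff_bijective.1 hs),
      Finset.mem_coe.2 (Finset.mem_univ _), by ext i; simp⟩

/-- The Cauchy–Binet expansion of an alternating map at a family of linear combinations. -/
theorem AlternatingMap.map_linearCombination_eq_sum_det {R M N ι : Type*} [CommRing R]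
    [AddCommGroup M] [Module R M] [AddCommGroup N] [Module R N] [LinearOrder ι] [Fintype ι] {k : ℕ}
    (f : M [⋀^Fin k]→ₗ[R] N) (C : Matrix (Fin k) ι R) (v : ι → M) :
    f (fun i => ∑ j, C i j • v j) =
      ∑ J ∈ (Finset.powersetCard k (Finset.univ : Finset ι)).attach,
        (C.submatrix id fun t =>
            (J.1.orderIsoOfFin (Finset.mem_powersetCard.mp J.2).2 t : ι)).det •
          f fun t => v (J.1.orderIsoOfFin (Finset.mem_powersetCard.mp J.2).2 t) := by
  have hexp : f (fun i => ∑ j, C i j • v j) =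
      ∑ r : Fin k → ι, (∏ i, C i (r i)) • f (fun i => v (r i)) := by
    rw [← f.coe_multilinearMap, MultilinearMap.map_sum]
    exact Finset.sum_congr rfl fun r _ => f.toMultilinearMap.map_smul_univ _ _
  have hinj : ∑ r : Fin k → ι, (∏ i, C i (r i)) • f (fun i => v (r i)) =
      ∑ r : Fin k → ι with Function.Injective r, (∏ i, C i (r i)) • f (fun i => v (r i)) := by
    refine (Finset.sum_filter_of_ne fun r _ hr => ?_).symm
    by_contra hni
    obtain ⟨a, b, hab, hne⟩ := Function.not_injective_iff.1 hni
    exact hr (by rw [f.map_eq_zero_of_eq _ (congrArg v hab) hne, smul_zero])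
  rw [hexp, hinj, ← Finset.sum_fiberwise_of_maps_to (t := Finset.powersetCard k Finset.univ)
    (g := fun r => Finset.univ.image r), ← Finset.sum_attach]
  · refine Finset.sum_congr rfl fun J _ => ?_
    rw [Finset.filter_filter, sum_image_eq_sum_perm J.1 (Finset.mem_powersetCard.mp J.2).2,
      ← Matrix.det_transpose, Matrix.det_apply, Finset.sum_smul]
    refine Finset.sum_congr rfl fun σ _ => ?_
    have hperm := f.map_perm
      (fun t => v (J.1.orderIsoOfFin (Finset.mem_powersetCard.mp J.2).2 t)) σ
    simp only [Function.comp_def] at hperm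
    rw [hperm, smul_comm, smul_assoc]
    rfl
  · intro r hr
    rw [Finset.mem_powersetCard]
    exact ⟨Finset.subset_univ _, by
      rw [Finset.card_image_of_injective _ (Finset.mem_filter.1 hr).2, Finset.card_univ,
        Fintype.card_fin]⟩

/-- Cauchy–Binet-type expansion of a twistor coordinate of `C * Z` in terms of
the Pluecker coordinates of `C`. -/
theorem stmt5 (k m n : ℕ)
    (C : Matrix (Fin k) (Fin n) ℝ) (Z : Matrix (Fin n) (Fin (k + m)) ℝ)
    (idx : Fin m → Fin n) :
    twist (C * Z) (fun j => Z (idx j)) =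
      ∑ J ∈ (Finset.powersetCard k (Finset.univ : Finset (Fin n))).attach,
        pluck C J.1 (Finset.mem_powersetCard.mp J.2).2 *
          (Matrix.of (Fin.append
            (fun t : Fin k =>
              Z ((J.1.orderIsoOfFin (Finset.mem_powersetCard.mp J.2).2 t).val))
            (fun j => Z (idx j)))).det := by
  have hrow : (C * Z : Matrix (Fin k) (Fin (k + m)) ℝ) = fun i => ∑ j, C i j • Z j := by
    ext i l
    simp [Matrix.mul_apply]
  have h := (Matrix.detRowAlternating.fixRight
    fun j => Z (idx j)).map_linearCombination_eq_sum_det C Z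
  rw [← hrow] at h
  exact h
end
end

section
/- Let k, m ≥ 0 with k + m ≤ n, let Z ∈ Mat^{>0}_{n,k+m}, and let W ∈ Gr_{k+m,n} be the column span of Z. Define the B-amplituhedron B_{n,k,m}(W) := {V^⊥ ∩ W : V ∈ Gr≥0_{k,n}} ⊆ Gr_{m,n}. Then the assignment V^⊥ ∩ W ↦ Z̃(V) is well defined (if V_1, V_2 ∈ Gr≥0_{k,n} satisfy V_1^⊥ ∩ W = V_2^⊥ ∩ W, then Z̃(V_1) = Z̃(V_2)) and is a homeomorphism from B_{n,k,m}(W) onto the amplituhedron A_{n,k,m}(Z), where B_{n,k,m}(W) and A_{n,k,m}(Z) carry the subspace topologies from the Grassmannian manifolds Gr_{m,n} and Gr_{k,k+m} respectively. -/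
noncomputable section

/-- All maximal (`p x p`) minors of the `n x p` matrix `Z` are positive. -/
def posMaxMinors {n p : ℕ} (Z : Matrix (Fin n) (Fin p) ℝ) : Prop :=
  ∀ (S : Finset (Fin n)) (h : S.card = p),
    0 < (Z.submatrix (fun t => ((S.orderIsoOfFin h) t).val) id).det

/-- The orthogonal complement of `V` with respect to the standard
bilinear form on `Fin n → ℝ`. -/
def perpSub {n : ℕ} (V : Submodule ℝ (Fin n → ℝ)) : Submodule ℝ (Fin n → ℝ) where
  carrier := {w | ∀ v ∈ V, ∑ i, v i * w i = 0}
  zero_mem' := by intro v hv; simp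
  add_mem' := by
    intro a b ha hb v hv
    have h1 := ha v hv
    have h2 := hb v hv
    have h3 : ∀ i, v i * (a + b) i = v i * a i + v i * b i := by
      intro i; simp [mul_add]
    rw [Finset.sum_congr rfl (fun i _ => h3 i), Finset.sum_add_distrib, h1, h2, add_zero]
  smul_mem' := by
    intro c a ha v hv
    have h := ha v hv
    have h3 : ∀ i, v i * (c • a) i = c * (v i * a i) := by
      intro i; simp [smul_eq_mul]; ring
    rw [Finset.sum_congr rfl (fun i _ => h3 i), ← Finset.mul_sum, h, mul_zero]

/-- Full-rank `k x n` real matrices (those with linearly independent rows). -/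
def FullRk (k n : ℕ) : Type :=
  {C : Matrix (Fin k) (Fin n) ℝ // LinearIndependent ℝ (fun i => C i)}

instance (k n : ℕ) : TopologicalSpace (FullRk k n) :=
  inferInstanceAs (TopologicalSpace
    {C : Matrix (Fin k) (Fin n) ℝ // LinearIndependent ℝ (fun i => C i)})

/-- Two full-rank matrices are equivalent iff they have the same row span. -/
def grSetoid (k n : ℕ) : Setoid (FullRk k n) :=
  ⟨fun C D => Submodule.span ℝ (Set.range (fun i => C.1 i)) =
      Submodule.span ℝ (Set.range (fun i => D.1 i)),
    ⟨fun _ => rfl, fun h => h.symm, fun h1 h2 => h1.trans h2⟩⟩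

/-- The real Grassmannian `Gr_{k,n}`: full-rank `k x n` matrices modulo row
operations, equipped with the quotient topology. -/
def Gr (k n : ℕ) : Type := Quotient (grSetoid k n)

instance (k n : ℕ) : TopologicalSpace (Gr k n) :=
  inferInstanceAs (TopologicalSpace (Quotient (grSetoid k n)))

/-- The point of `Gr k n` represented by the full-rank matrix `C`. -/
def grMk {k n : ℕ} (C : Matrix (Fin k) (Fin n) ℝ)
    (h : LinearIndependent ℝ (fun i => C i)) : Gr k n :=
  Quotient.mk (grSetoid k n) ⟨C, h⟩

open Matrix Topology

/-- The span of the rows of a matrix. -/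
def rowSpan {k n : ℕ} (C : Matrix (Fin k) (Fin n) ℝ) : Submodule ℝ (Fin n → ℝ) :=
  Submodule.span ℝ (Set.range (fun i => C i))

lemma finrank_rowSpan {k n : ℕ} {C : Matrix (Fin k) (Fin n) ℝ}
    (hC : LinearIndependent ℝ (fun i => C i)) : Module.finrank ℝ (rowSpan C) = k := by
  rw [rowSpan, finrank_span_eq_card hC, Fintype.card_fin]

lemma rowSpan_mul {k n p : ℕ} (C : Matrix (Fin k) (Fin n) ℝ) (M : Matrix (Fin n) (Fin p) ℝ) :
    rowSpan (C * M) = (rowSpan C).map M.vecMulLinear := by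
  rw [rowSpan, rowSpan, Submodule.map_span, ← Set.range_comp]
  rfl

lemma exists_rowSpan_eq {k n : ℕ} (S : Submodule ℝ (Fin n → ℝ))
    (hS : Module.finrank ℝ S = k) :
    ∃ C : Matrix (Fin k) (Fin n) ℝ, LinearIndependent ℝ (fun i => C i) ∧ rowSpan C = S := by
  let b := Module.finBasisOfFinrankEq ℝ S hS
  refine ⟨fun i => (b i : Fin n → ℝ), b.linearIndependent.map' S.subtype S.ker_subtype, ?_⟩
  have h : Set.range (fun i => (b i : Fin n → ℝ)) = S.subtype '' Set.range b := by
    rw [← Set.range_comp]; rfl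
  change Submodule.span ℝ (Set.range (fun i => (b i : Fin n → ℝ))) = S
  rw [h, ← Submodule.map_span, b.span_eq, Submodule.map_top, Submodule.range_subtype]

lemma perpSub_eq_orthogonal {n : ℕ} (V : Submodule ℝ (Fin n → ℝ)) :
    perpSub V = LinearMap.BilinForm.orthogonal (dotProductBilin ℝ ℝ) V := rfl

lemma nondegenerate_dotProductBilin (n : ℕ) :
    LinearMap.BilinForm.Nondegenerate
      (dotProductBilin ℝ ℝ : LinearMap.BilinForm ℝ (Fin n → ℝ)) :=
  ⟨fun x hx => dotProduct_self_eq_zero.1 (hx x), fun x hx => dotProduct_self_eq_zero.1 (hx x)⟩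

lemma isRefl_dotProductBilin (n : ℕ) :
    LinearMap.BilinForm.IsRefl (dotProductBilin ℝ ℝ : LinearMap.BilinForm ℝ (Fin n → ℝ)) :=
  fun x y h => (dotProduct_comm y x).trans h

lemma finrank_perpSub {n : ℕ} (V : Submodule ℝ (Fin n → ℝ)) :
    Module.finrank ℝ (perpSub V) = n - Module.finrank ℝ V := by
  rw [perpSub_eq_orthogonal,
    LinearMap.BilinForm.finrank_orthogonal (nondegenerate_dotProductBilin n)]
  simp

lemma perpSub_perpSub {n : ℕ} (V : Submodule ℝ (Fin n → ℝ)) : perpSub (perpSub V) = V :=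
  LinearMap.BilinForm.orthogonal_orthogonal (nondegenerate_dotProductBilin n)
    (isRefl_dotProductBilin n) V

lemma mem_perpSub_rowSpan {k n : ℕ} (C : Matrix (Fin k) (Fin n) ℝ) (w : Fin n → ℝ) :
    w ∈ perpSub (rowSpan C) ↔ C *ᵥ w = 0 := by
  constructor
  · intro h
    ext i
    exact h (C i) (Submodule.subset_span ⟨i, rfl⟩)
  · intro h v hv
    induction hv using Submodule.span_induction with
    | mem v hv =>
      obtain ⟨i, rfl⟩ := hv
      exact congrFun h i
    | zero => simp
    | add x y _ _ hx hy => simp [add_mul, Finset.sum_add_distrib, hx, hy]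
    | smul a x _ hx => simp [mul_assoc, ← Finset.mul_sum, hx]

/-- A linearly independent family of rows orthogonal to those of `X` spans the orthogonal complement
as soon as the dimensions add up. -/
lemma rowSpan_eq_perpSub {a b n : ℕ} (hab : a + b = n) {X : Matrix (Fin a) (Fin n) ℝ}
    {Y : Matrix (Fin b) (Fin n) ℝ} (hX : LinearIndependent ℝ (fun i => X i))
    (hY : LinearIndependent ℝ (fun i => Y i)) (h : X * Yᵀ = 0) :
    rowSpan Y = perpSub (rowSpan X) := by
  refine Submodule.eq_of_le_of_finrank_eq (Submodule.span_le.2 ?_) ?_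
  · rintro _ ⟨i, rfl⟩
    refine (mem_perpSub_rowSpan X _).2 ?_
    ext j
    exact congrFun (congrFun h j) i
  · rw [finrank_perpSub, finrank_rowSpan hX, finrank_rowSpan hY]
    omega

lemma perpSub_inf_colSpan {k n p : ℕ} (C : Matrix (Fin k) (Fin n) ℝ)
    (Z : Matrix (Fin n) (Fin p) ℝ) :
    perpSub (rowSpan C) ⊓ rowSpan Zᵀ = (perpSub (rowSpan (C * Z))).map Zᵀ.vecMulLinear := by
  have hZ : ∀ w, w ∈ rowSpan Zᵀ ↔ ∃ x, Z *ᵥ x = w := by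
    intro w
    have := Matrix.range_mulVecLin Z
    change w ∈ Submodule.span ℝ (Set.range Z.col) ↔ _
    rw [← this]
    rfl
  ext w
  rw [Submodule.mem_inf, mem_perpSub_rowSpan, hZ, Submodule.mem_map]
  constructor
  · rintro ⟨h, x, rfl⟩
    exact ⟨x, (mem_perpSub_rowSpan _ _).2 (by rwa [← mulVec_mulVec]), by simp⟩
  · rintro ⟨x, hx, rfl⟩
    rw [mem_perpSub_rowSpan, ← mulVec_mulVec] at hx
    simp only [vecMulLinear_apply, vecMul_transpose]
    exact ⟨hx, x, rfl⟩

/-- A polynomial version of the orthogonal projection of the rows of `D` to the orthogonal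
complement of the rows of `X`. -/
def projPerp {a b n : ℕ} (D : Matrix (Fin b) (Fin n) ℝ) (X : Matrix (Fin a) (Fin n) ℝ) :
    Matrix (Fin b) (Fin n) ℝ :=
  (X * Xᵀ).det • D - D * Xᵀ * (X * Xᵀ).adjugate * X

lemma mul_transpose_projPerp {a b n : ℕ} (D : Matrix (Fin b) (Fin n) ℝ)
    (X : Matrix (Fin a) (Fin n) ℝ) : X * (projPerp D X)ᵀ = 0 := by
  have h : projPerp D X * Xᵀ = 0 := by
    rw [projPerp, Matrix.sub_mul, Matrix.mul_assoc _ X, Matrix.mul_assoc _ _ (X * Xᵀ),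
      adjugate_mul]
    simp
  simpa using congrArg Matrix.transpose h

lemma continuous_projPerp {a b n : ℕ} (D : Matrix (Fin b) (Fin n) ℝ) :
    Continuous (projPerp D : Matrix (Fin a) (Fin n) ℝ → _) := by
  unfold projPerp
  fun_prop

lemma det_mul_transpose_ne_zero {a n : ℕ} {X : Matrix (Fin a) (Fin n) ℝ}
    (hX : LinearIndependent ℝ (fun i => X i)) : (X * Xᵀ).det ≠ 0 := by
  intro h
  obtain ⟨v, hv, hv'⟩ := exists_vecMul_eq_zero_iff.2 h
  have h0 : (v ᵥ* X) ⬝ᵥ (v ᵥ* X) = 0 := by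
    have := congrArg (· ⬝ᵥ v) hv'
    simpa [← vecMul_vecMul, vecMul_transpose, dotProduct_comm, dotProduct_mulVec] using this
  exact hv (vecMul_injective_iff.2 hX ((dotProduct_self_eq_zero.1 h0).trans (zero_vecMul X).symm))

lemma linearIndependent_projPerp {a b n : ℕ} {D : Matrix (Fin b) (Fin n) ℝ}
    {X : Matrix (Fin a) (Fin n) ℝ} (hX : LinearIndependent ℝ (fun i => X i))
    (hD : LinearIndependent ℝ (fun i => D i)) (hXD : rowSpan D = perpSub (rowSpan X)) :
    LinearIndependent ℝ (fun i => projPerp D X i) := by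
  have h : D * Xᵀ = 0 := by
    ext i j
    have hi : D i ∈ perpSub (rowSpan X) := hXD ▸ Submodule.subset_span ⟨i, rfl⟩
    have := hi (X j) (Submodule.subset_span ⟨j, rfl⟩)
    simpa [Matrix.mul_apply, mul_comm] using this
  have h' : projPerp D X = (X * Xᵀ).det • D := by simp [projPerp, h]
  rw [h']
  exact hD.units_smul (fun _ => Units.mk0 _ (det_mul_transpose_ne_zero hX))

lemma isOpen_setOf_linearIndependent_rows (k n : ℕ) :
    IsOpen {C : Matrix (Fin k) (Fin n) ℝ | LinearIndependent ℝ (fun i => C i)} :=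
  isOpen_setOfPred_linearIndependent (𝕜 := ℝ) (E := Fin n → ℝ) (ι := Fin k)

lemma linearIndependent_rows_mul {k n p : ℕ} {C : Matrix (Fin k) (Fin n) ℝ}
    (hC : LinearIndependent ℝ (fun i => C i)) {M : Matrix (Fin n) (Fin p) ℝ}
    {N : Matrix (Fin p) (Fin n) ℝ} (h : M * N = 1) :
    LinearIndependent ℝ (fun i => (C * M) i) := by
  refine hC.map' M.vecMulLinear (LinearMap.ker_eq_bot.2 fun x y hxy => ?_)
  have := congrArg (· ᵥ* N) hxy
  simpa [vecMul_vecMul, h] using this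

/-- The subspace corresponding to a point of the Grassmannian. -/
def grSpan {k n : ℕ} : Gr k n → Submodule ℝ (Fin n → ℝ) :=
  Quotient.lift (fun C => rowSpan C.1) (fun _ _ h => h)

/-- The quotient map from full-rank matrices to the Grassmannian. -/
def grProj {k n : ℕ} (C : FullRk k n) : Gr k n := Quotient.mk (grSetoid k n) C

lemma isQuotientMap_grProj (k n : ℕ) : IsQuotientMap (grProj : FullRk k n → Gr k n) :=
  isQuotientMap_quotient_mk'

lemma grSpan_grProj {k n : ℕ} (C : FullRk k n) : grSpan (grProj C) = rowSpan C.1 := rfl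

lemma grSpan_injective {k n : ℕ} : Function.Injective (grSpan : Gr k n → _) := by
  rintro ⟨C⟩ ⟨D⟩ h
  exact Quotient.sound h

lemma finrank_grSpan {k n : ℕ} (P : Gr k n) : Module.finrank ℝ (grSpan P) = k := by
  obtain ⟨C⟩ := P
  exact finrank_rowSpan C.2

lemma exists_grSpan_eq {k n : ℕ} {S : Submodule ℝ (Fin n → ℝ)} (hS : Module.finrank ℝ S = k) :
    ∃ P : Gr k n, grSpan P = S := by
  obtain ⟨C, hC, h⟩ := exists_rowSpan_eq S hS
  exact ⟨grMk C hC, h⟩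

/-- To check continuity of a map of Grassmannians on an open set it suffices to lift it near each
matrix to a continuous map of matrices. -/
lemma continuousOn_gr {a b c d : ℕ} {U : Set (Gr a b)} (hU : IsOpen U) (f : Gr a b → Gr c d)
    (h : ∀ X₀ : FullRk a b, grProj X₀ ∈ U →
      ∃ g : Matrix (Fin a) (Fin b) ℝ → Matrix (Fin c) (Fin d) ℝ, Continuous g ∧
        LinearIndependent ℝ (fun i => g X₀.1 i) ∧
        ∀ X : FullRk a b, grProj X ∈ U →
          LinearIndependent ℝ (fun i => g X.1 i) →
          grSpan (f (grProj X)) = rowSpan (g X.1)) :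
    ContinuousOn f U := by
  classical
  have hq := isQuotientMap_grProj a b
  have hqc := (isQuotientMap_grProj c d).continuous
  rw [hq.continuousOn_isOpen_iff hU]
  intro X₀ hX₀
  obtain ⟨g, hg, hg₀, hgf⟩ := h X₀ hX₀
  have hval : Continuous (fun X : FullRk a b => X.1) := continuous_subtype_val
  have hgv : Continuous (fun X : FullRk a b => g X.1) := hg.comp hval
  have hev : ∀ᶠ X : FullRk a b in 𝓝 X₀, LinearIndependent ℝ (fun i => g X.1 i) :=
    hgv.continuousAt.eventually ((isOpen_setOf_linearIndependent_rows c d).mem_nhds hg₀)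
  let l : FullRk a b → FullRk c d := fun X =>
    if hX : LinearIndependent ℝ (fun i => g X.1 i) then ⟨g X.1, hX⟩ else ⟨g X₀.1, hg₀⟩
  have hlX : ∀ X : FullRk a b, LinearIndependent ℝ (fun i => g X.1 i) → (l X).1 = g X.1 :=
    fun X hX => congrArg Subtype.val (dif_pos hX)
  have hl : ContinuousAt l X₀ := by
    refine Topology.IsInducing.subtypeVal.continuousAt_iff.2 ?_
    refine hgv.continuousAt.congr ?_
    filter_upwards [hev] with X hX
    exact (hlX X hX).symm
  refine ((hqc.continuousAt.comp hl).congr ?_).continuousWithinAt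
  filter_upwards [hev, (hU.preimage hq.continuous).mem_nhds hX₀] with X hX hXU
  refine grSpan_injective ?_
  simp only [Function.comp_apply]
  rw [hgf X hXU hX, grSpan_grProj, hlX X hX]

lemma nonempty_gr {k n : ℕ} (h : k ≤ n) : Nonempty (Gr k n) :=
  ⟨grMk (fun i => Pi.basisFun ℝ (Fin n) (Fin.castLE h i))
    ((Pi.basisFun ℝ (Fin n)).linearIndependent.comp _ (Fin.castLE_injective h))⟩

lemma exists_transpose_mul_eq_one {n p : ℕ} (hp : p ≤ n) {Z : Matrix (Fin n) (Fin p) ℝ}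
    (hZ : posMaxMinors Z) : ∃ L : Matrix (Fin n) (Fin p) ℝ, Zᵀ * L = 1 := by
  obtain ⟨S, -, hS⟩ := Finset.exists_subset_card_eq
    (s := (Finset.univ : Finset (Fin n))) (n := p) (by simpa using hp)
  have hN := (hZ S hS).ne'
  have hinj : Function.Injective Z.mulVec := by
    intro x y hxy
    refine mulVec_injective_of_det_ne_zero hN (funext fun i => ?_)
    exact congrFun hxy _
  have hli : LinearIndependent ℝ (fun i => Zᵀ i) := mulVec_injective_iff.1 hinj
  refine ⟨Z * (Zᵀ * Z)⁻¹, ?_⟩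
  rw [← Matrix.mul_assoc]
  exact mul_nonsing_inv _ (isUnit_iff_ne_zero.2 (by simpa using det_mul_transpose_ne_zero hli))

/-- The map on Grassmannians sending `P` to the image of its orthogonal complement under `M` is
continuous. -/
lemma exists_continuous_map_perp {k m p n : ℕ} (hp : k + m = p) {M : Matrix (Fin p) (Fin n) ℝ}
    {N : Matrix (Fin n) (Fin p) ℝ} (h : M * N = 1) :
    ∃ G : Gr k p → Gr m n, Continuous G ∧
      ∀ P, grSpan (G P) = (perpSub (grSpan P)).map M.vecMulLinear := by
  have hex : ∀ P : Gr k p, ∃ Q : Gr m n,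
      grSpan Q = (perpSub (grSpan P)).map M.vecMulLinear := by
    intro P
    obtain ⟨D, hD, hDP⟩ := exists_rowSpan_eq (k := m) (perpSub (grSpan P))
      (by rw [finrank_perpSub, finrank_grSpan]; omega)
    exact ⟨grMk (D * M) (linearIndependent_rows_mul hD h), by
      rw [← hDP, ← rowSpan_mul]; rfl⟩
  choose G hG using hex
  refine ⟨G, continuousOn_univ.1 (continuousOn_gr isOpen_univ G fun X₀ _ => ?_), hG⟩
  obtain ⟨D, hD, hDX⟩ := exists_rowSpan_eq (k := m) (perpSub (rowSpan X₀.1))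
    (by rw [finrank_perpSub, finrank_rowSpan X₀.2]; omega)
  refine ⟨fun X => projPerp D X * M, (continuous_projPerp D).matrix_mul continuous_const,
    linearIndependent_rows_mul (linearIndependent_projPerp X₀.2 hD hDX) h, fun X _ hX => ?_⟩
  rw [hG, grSpan_grProj, rowSpan_mul, rowSpan_eq_perpSub hp X.2
    (LinearIndependent.of_comp M.vecMulLinear hX) (mul_transpose_projPerp D X.1)]

/-- The map on Grassmannians sending `Q` to the orthogonal complement of its image under `L` is
continuous where this image has full dimension. -/
lemma exists_continuousOn_perp_map {k m p n : ℕ} (hp : k + m = p) (L : Matrix (Fin n) (Fin p) ℝ) :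
    ∃ T : Gr m n → Gr k p,
      ContinuousOn T {Q | Module.finrank ℝ ((grSpan Q).map L.vecMulLinear) = m} ∧
      ∀ Q, Module.finrank ℝ ((grSpan Q).map L.vecMulLinear) = m →
        grSpan (T Q) = perpSub ((grSpan Q).map L.vecMulLinear) := by
  have := nonempty_gr (show k ≤ p by omega)
  set U := {Q : Gr m n | Module.finrank ℝ ((grSpan Q).map L.vecMulLinear) = m} with hU
  have hex : ∀ Q : Gr m n, ∃ P : Gr k p, Q ∈ U →
      grSpan P = perpSub ((grSpan Q).map L.vecMulLinear) := by
    intro Q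
    by_cases hQ : Q ∈ U
    · obtain ⟨P, hP⟩ := exists_grSpan_eq (k := k)
        (S := perpSub ((grSpan Q).map L.vecMulLinear))
        (by rw [finrank_perpSub, show Module.finrank ℝ _ = m from hQ]; omega)
      exact ⟨P, fun _ => hP⟩
    · exact ⟨Classical.arbitrary _, fun h => absurd h hQ⟩
  choose T hT using hex
  have hli : ∀ X : FullRk m n, grProj X ∈ U ↔
      LinearIndependent ℝ (fun i => (X.1 * L) i) := by
    intro X
    have hspan : (grSpan (grProj X)).map L.vecMulLinear =
      rowSpan (X.1 * L) := (rowSpan_mul X.1 L).symm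
    rw [hU, Set.mem_ofPred_eq, hspan, linearIndependent_iff_card_eq_finrank_span]
    rw [Fintype.card_fin]
    exact eq_comm
  have hUo : IsOpen U := by
    have hq := isQuotientMap_grProj m n
    have hval : Continuous (fun X : FullRk m n => X.1) := continuous_subtype_val
    rw [← hq.isOpen_preimage]
    convert (isOpen_setOf_linearIndependent_rows m p).preimage
      (hval.matrix_mul (continuous_const (y := L))) using 1
    ext X
    exact hli X
  refine ⟨T, continuousOn_gr hUo T fun X₀ hX₀ => ?_, hT⟩
  rw [hli] at hX₀
  obtain ⟨D, hD, hDX⟩ := exists_rowSpan_eq (k := k) (perpSub (rowSpan (X₀.1 * L)))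
    (by rw [finrank_perpSub, finrank_rowSpan hX₀]; omega)
  refine ⟨fun X => projPerp D (X * L),
    (continuous_projPerp D).comp (continuous_id.matrix_mul continuous_const),
    linearIndependent_projPerp hX₀ hD hDX, fun X hXU hX => ?_⟩
  rw [hT _ hXU, rowSpan_eq_perpSub (by omega) ((hli X).1 hXU) hX (mul_transpose_projPerp _ _),
    rowSpan_mul, grSpan_grProj]
/-- The map `V^⊥ ∩ W ↦ Z~(V)` is well defined and is a homeomorphism from the
B-amplituhedron `B_{n,k,m}(W)` onto the amplituhedron `A_{n,k,m}(Z)`. -/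
theorem stmt7 (k m n : ℕ) (hkm : k + m ≤ n)
    (Z : Matrix (Fin n) (Fin (k + m)) ℝ) (hZ : posMaxMinors Z)
    (W : Submodule ℝ (Fin n → ℝ))
    (hW : W = Submodule.span ℝ (Set.range (fun j => (Matrix.transpose Z) j)))
    (B : Set (Gr m n))
    (hB : B = {Q | ∃ (C : Matrix (Fin k) (Fin n) ℝ)
        (hC : LinearIndependent ℝ (fun i => C i)),
        (∀ (S : Finset (Fin n)) (h : S.card = k), 0 ≤ pluck C S h) ∧
        ∃ (D : Matrix (Fin m) (Fin n) ℝ)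
          (hD : LinearIndependent ℝ (fun i => D i)),
          grMk D hD = Q ∧
          Submodule.span ℝ (Set.range (fun i => D i)) =
            perpSub (Submodule.span ℝ (Set.range (fun i => C i))) ⊓ W})
    (A : Set (Gr k (k + m)))
    (hA : A = {P | ∃ (C : Matrix (Fin k) (Fin n) ℝ)
        (hC : LinearIndependent ℝ (fun i => C i)),
        (∀ (S : Finset (Fin n)) (h : S.card = k), 0 ≤ pluck C S h) ∧
        ∃ (E : Matrix (Fin k) (Fin (k + m)) ℝ)
          (hE : LinearIndependent ℝ (fun i => E i)),
          grMk E hE = P ∧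
          Submodule.span ℝ (Set.range (fun i => E i)) =
            Submodule.span ℝ (Set.range (fun i => (C * Z) i))}) :
    (∀ (C₁ C₂ : Matrix (Fin k) (Fin n) ℝ),
      LinearIndependent ℝ (fun i => C₁ i) →
      LinearIndependent ℝ (fun i => C₂ i) →
      (∀ (S : Finset (Fin n)) (h : S.card = k), 0 ≤ pluck C₁ S h) →
      (∀ (S : Finset (Fin n)) (h : S.card = k), 0 ≤ pluck C₂ S h) →
      perpSub (Submodule.span ℝ (Set.range (fun i => C₁ i))) ⊓ W =
        perpSub (Submodule.span ℝ (Set.range (fun i => C₂ i))) ⊓ W →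
      Submodule.span ℝ (Set.range (fun i => (C₁ * Z) i)) =
        Submodule.span ℝ (Set.range (fun i => (C₂ * Z) i))) ∧
    ∃ F : ↥B ≃ₜ ↥A,
      ∀ (C : Matrix (Fin k) (Fin n) ℝ)
        (hC : LinearIndependent ℝ (fun i => C i)),
        (∀ (S : Finset (Fin n)) (h : S.card = k), 0 ≤ pluck C S h) →
        ∀ (D : Matrix (Fin m) (Fin n) ℝ)
          (hD : LinearIndependent ℝ (fun i => D i)),
          Submodule.span ℝ (Set.range (fun i => D i)) =
            perpSub (Submodule.span ℝ (Set.range (fun i => C i))) ⊓ W →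
          ∀ hQ : grMk D hD ∈ B,
          ∀ (E : Matrix (Fin k) (Fin (k + m)) ℝ)
            (hE : LinearIndependent ℝ (fun i => E i)),
            Submodule.span ℝ (Set.range (fun i => E i)) =
              Submodule.span ℝ (Set.range (fun i => (C * Z) i)) →
            (F ⟨grMk D hD, hQ⟩).val = grMk E hE := by
  obtain ⟨L, hL⟩ := exists_transpose_mul_eq_one hkm hZ
  have hLZ : ∀ S : Submodule ℝ (Fin (k + m) → ℝ),
      (S.map Zᵀ.vecMulLinear).map L.vecMulLinear = S := by
    intro S
    rw [← Submodule.map_comp]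
    convert Submodule.map_id S
    refine LinearMap.ext fun x => ?_
    change (x ᵥ* Zᵀ) ᵥ* L = x
    rw [vecMul_vecMul, hL, vecMul_one]
  have hperp : ∀ C : Matrix (Fin k) (Fin n) ℝ, perpSub (rowSpan C) ⊓ W =
      (perpSub (rowSpan (C * Z))).map Zᵀ.vecMulLinear := fun C => by
    rw [hW]; exact perpSub_inf_colSpan C Z
  have hback : ∀ C : Matrix (Fin k) (Fin n) ℝ,
      perpSub ((perpSub (rowSpan C) ⊓ W).map L.vecMulLinear) = rowSpan (C * Z) := fun C => by
    rw [hperp, hLZ, perpSub_perpSub]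
  refine ⟨fun C₁ C₂ _ _ _ _ h => ?_, ?_⟩
  · change rowSpan (C₁ * Z) = rowSpan (C₂ * Z)
    rw [← hback C₁, ← hback C₂]
    exact congrArg (fun S => perpSub (Submodule.map L.vecMulLinear S)) h
  obtain ⟨G, hGc, hG⟩ := exists_continuous_map_perp (k := k) (m := m) rfl hL
  obtain ⟨T, hTc, hT⟩ := exists_continuousOn_perp_map (k := k) (m := m) rfl L
  have hBmem : ∀ Q, Q ∈ B ↔ ∃ C : Matrix (Fin k) (Fin n) ℝ,
      LinearIndependent ℝ (fun i => C i) ∧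
      (∀ (S : Finset (Fin n)) (h : S.card = k), 0 ≤ pluck C S h) ∧
      grSpan Q = perpSub (rowSpan C) ⊓ W := by
    intro Q
    rw [hB]
    constructor
    · rintro ⟨C, hC, hpos, D, hD, rfl, h⟩
      exact ⟨C, hC, hpos, h⟩
    · rintro ⟨C, hC, hpos, h⟩
      obtain ⟨⟨D, hD⟩⟩ := Q
      exact ⟨C, hC, hpos, D, hD, rfl, h⟩
  have hAmem : ∀ P, P ∈ A ↔ ∃ C : Matrix (Fin k) (Fin n) ℝ,
      LinearIndependent ℝ (fun i => C i) ∧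
      (∀ (S : Finset (Fin n)) (h : S.card = k), 0 ≤ pluck C S h) ∧
      grSpan P = rowSpan (C * Z) := by
    intro P
    rw [hA]
    constructor
    · rintro ⟨C, hC, hpos, E, hE, rfl, h⟩
      exact ⟨C, hC, hpos, h⟩
    · rintro ⟨C, hC, hpos, h⟩
      obtain ⟨⟨E, hE⟩⟩ := P
      exact ⟨C, hC, hpos, E, hE, rfl, h⟩
  have hTspan : ∀ Q (C : Matrix (Fin k) (Fin n) ℝ), grSpan Q = perpSub (rowSpan C) ⊓ W →
      Module.finrank ℝ ((grSpan Q).map L.vecMulLinear) = m ∧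
        grSpan (T Q) = rowSpan (C * Z) := by
    intro Q C h
    have hfin : Module.finrank ℝ ((grSpan Q).map L.vecMulLinear) = m := by
      have hinj : Function.Injective Zᵀ.vecMulLinear := fun x y hxy => by
        have h' : (x ᵥ* Zᵀ) ᵥ* L = (y ᵥ* Zᵀ) ᵥ* L := congrArg (· ᵥ* L) hxy
        rwa [vecMul_vecMul, vecMul_vecMul, hL, vecMul_one, vecMul_one] at h'
      have hQ := finrank_grSpan Q
      rw [h, hperp, ← (Submodule.equivMapOfInjective _ hinj _).finrank_eq] at hQ
      rw [h, hperp, hLZ, hQ]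
    exact ⟨hfin, by rw [hT Q hfin, h, hback]⟩
  have hGspan : ∀ P (C : Matrix (Fin k) (Fin n) ℝ), grSpan P = rowSpan (C * Z) →
      grSpan (G P) = perpSub (rowSpan C) ⊓ W := by
    intro P C h
    rw [hG, h, hperp]
  have hTA : ∀ Q ∈ B, T Q ∈ A := by
    intro Q hQ
    obtain ⟨C, hC, hpos, h⟩ := (hBmem Q).1 hQ
    exact (hAmem _).2 ⟨C, hC, hpos, (hTspan Q C h).2⟩
  have hGB : ∀ P ∈ A, G P ∈ B := by
    intro P hP
    obtain ⟨C, hC, hpos, h⟩ := (hAmem P).1 hP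
    exact (hBmem _).2 ⟨C, hC, hpos, hGspan P C h⟩
  have hTB : ContinuousOn T B := hTc.mono fun Q hQ => by
    obtain ⟨C, hC, hpos, h⟩ := (hBmem Q).1 hQ
    exact (hTspan Q C h).1
  refine ⟨{ toFun := fun Q => ⟨T Q, hTA Q Q.2⟩
            invFun := fun P => ⟨G P, hGB P P.2⟩
            left_inv := ?_
            right_inv := ?_
            continuous_toFun := (continuousOn_iff_continuous_domRestrict.1 hTB).subtype_mk _
            continuous_invFun := (hGc.comp continuous_subtype_val).subtype_mk _ }, ?_⟩
  · rintro ⟨Q, hQ⟩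
    obtain ⟨C, hC, hpos, h⟩ := (hBmem Q).1 hQ
    exact Subtype.ext (grSpan_injective ((hGspan _ C (hTspan Q C h).2).trans h.symm))
  · rintro ⟨P, hP⟩
    obtain ⟨C, hC, hpos, h⟩ := (hAmem P).1 hP
    exact Subtype.ext (grSpan_injective ((hTspan _ C (hGspan P C h)).2.trans h.symm))
  · intro C hC hpos D hD hDC hQ E hE hEC
    exact grSpan_injective ((hTspan (grMk D hD) C hDC).2.trans hEC.symm)
end
end

section
/- Let 0 < k < n and Z ∈ Mat^{>0}_{n,k+1} with rows Z_1,…,Z_n. Then the amplituhedron satisfies A_{n,k,1}(Z) = {Y ∈ Gr_{k,k+1} : var̄(⟨Y Z_1⟩, ⟨Y Z_2⟩, …, ⟨Y Z_n⟩) = k}. -/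
noncomputable section

/-- `varBar v` is `var-bar(v)`: the maximum of `var(w)` over all `w` agreeing
with `v` on the nonzero entries of `v`. -/
def varBar {n : ℕ} (v : Fin n → ℝ) : ℕ :=
  sSup {m | ∃ w : Fin n → ℝ, (∀ i, v i ≠ 0 → w i = v i) ∧ signChanges w = m}

theorem Fin.strictMono_eq_cons_or_succ {k n : ℕ} {f : Fin (k + 1) → Fin (n + 1)} (hf : StrictMono f) :
    (∃ f' : Fin k → Fin n, StrictMono f' ∧ f = Fin.cons 0 (Fin.succ ∘ f')) ∨
      ∃ f' : Fin (k + 1) → Fin n, StrictMono f' ∧ f = Fin.succ ∘ f' := by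
  by_cases h0 : f 0 = 0
  · left
    have hne : ∀ i : Fin k, f i.succ ≠ 0 := fun i h => by
      have := hf (Fin.succ_pos i)
      rw [h0, h] at this
      exact lt_irrefl _ this
    refine ⟨fun i => (f i.succ).pred (hne i), ?_, ?_⟩
    · intro a b hab
      exact Fin.pred_lt_pred_iff.2 (hf (Fin.succ_lt_succ_iff.2 hab))
    · ext i
      refine Fin.cases ?_ (fun i => ?_) i <;> simp [h0]
  · right
    have hne : ∀ i, f i ≠ 0 := fun i h => by
      have := hf.monotone (Fin.zero_le i)
      rw [h] at this
      exact h0 (Fin.le_zero_iff.1 this)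
    refine ⟨fun i => (f i).pred (hne i), ?_, ?_⟩
    · intro a b hab
      exact Fin.pred_lt_pred_iff.2 (hf hab)
    · ext i
      simp

theorem Fin.strictMono_of_one {n : ℕ} (f : Fin (0 + 1) → Fin n) : StrictMono f :=
  fun a b h => absurd h (by simp [Fin.fin_one_eq_zero a, Fin.fin_one_eq_zero b])

theorem StrictMono.fin_cons_zero_succ {k n : ℕ} {f : Fin k → Fin n} (hf : StrictMono f) :
    StrictMono (Fin.cons 0 (Fin.succ ∘ f) : Fin (k + 1) → Fin (n + 1)) := by
  intro a b
  refine Fin.cases ?_ (fun a => ?_) a <;> refine Fin.cases ?_ (fun b => ?_) b <;> intro h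
  · exact absurd h (lt_irrefl _)
  · simp
  · exact absurd h (by simp)
  · simpa using hf (Fin.succ_lt_succ_iff.1 h)

namespace AlternatingMap

variable {E : Type*} [AddCommGroup E] [Module ℝ E]

theorem exists_strictMono_ne_zero {k n : ℕ} (ω : E [⋀^Fin k]→ₗ[ℝ] ℝ) {c : Fin n → E}
    {h : Fin k → Fin n} (hh : ω (c ∘ h) ≠ 0) :
    ∃ f : Fin k → Fin n, StrictMono f ∧ Set.range f = Set.range h ∧ ω (c ∘ f) ≠ 0 := by
  have hinj : Function.Injective h := by
    intro a b hab
    by_contra hne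
    exact hh (ω.map_eq_zero_of_eq _ (by simp [hab]) hne)
  refine ⟨h ∘ Tuple.sort h, (Tuple.monotone_sort h).strictMono_of_injective
    (hinj.comp (Tuple.sort h).injective), ?_, ?_⟩
  · exact (Tuple.sort h).surjective.range_comp h
  · rw [← Function.comp_assoc, ω.map_perm]
    rcases Int.units_eq_one_or (Equiv.Perm.sign (Tuple.sort h)) with e | e <;> simpa [e] using hh

theorem comp_fin_cons {α : Type*} {k n : ℕ} (c : Fin n → α) (i : Fin n) (f : Fin k → Fin n) :
    c ∘ (Fin.cons i f : Fin (k + 1) → Fin n) = Matrix.vecCons (c i) (c ∘ f) := by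
  ext j
  refine Fin.cases ?_ (fun j => ?_) j <;> simp

theorem map_vecCons_vecCons_neg {k : ℕ} (ω : E [⋀^Fin (k + 2)]→ₗ[ℝ] ℝ) (x y : E) (u : Fin k → E) :
    ω (Matrix.vecCons x (Matrix.vecCons (-y) u)) = ω (Matrix.vecCons y (Matrix.vecCons x u)) := by
  have h := ω.map_swap (Matrix.vecCons y (Matrix.vecCons x u)) (i := 0) (j := 1) (by simp)
  have e : Matrix.vecCons y (Matrix.vecCons x u) ∘ Equiv.swap (0 : Fin (k + 2)) 1 =
      Matrix.vecCons x (Matrix.vecCons y u) := by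
    ext j
    refine Fin.cases ?_ (fun j => Fin.cases ?_ (fun j => ?_) j) j
    · simp
    · simp
    · rw [Function.comp_apply, Equiv.swap_apply_of_ne_of_ne]
      · simp
      · exact Fin.succ_ne_zero _
      · simp [Fin.ext_iff]
  rw [e] at h
  have h2 := (ω.curryLeft x).map_vecCons_smul u (-1) y
  simp only [curryLeft_apply_apply, neg_smul, one_smul] at h2
  linarith

end AlternatingMap

/-- The sequence `u` has weakly alternating signs. -/
def WeaklyAlternating {m : ℕ} (u : Fin m → ℝ) : Prop :=
  ∃ s : ℝ, s ^ 2 = 1 ∧ ∀ j : Fin m, 0 ≤ s * (-1) ^ (j : ℕ) * u j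

theorem exists_sign_mul_nonneg (a : ℝ) : ∃ s : ℝ, s ^ 2 = 1 ∧ 0 ≤ s * a := by
  rcases le_total 0 a with h | h
  · exact ⟨1, by norm_num, by linarith⟩
  · exact ⟨-1, by norm_num, by linarith⟩

theorem weaklyAlternating_cons {m : ℕ} {s a : ℝ} {u : Fin m → ℝ} (hs : s ^ 2 = 1)
    (hu : ∀ j : Fin m, 0 ≤ s * (-1) ^ (j : ℕ) * u j) (ha : s * a ≤ 0) :
    WeaklyAlternating (Matrix.vecCons a u) := by
  refine ⟨-s, by simpa using hs, fun j => ?_⟩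
  refine Fin.cases ?_ (fun j => ?_) j
  · simpa using ha
  · have := hu j
    simp only [Fin.val_succ, Matrix.cons_val_succ, pow_succ]
    linarith

theorem weaklyAlternating_cons_zero {m : ℕ} (a : ℝ) : 
    WeaklyAlternating (Matrix.vecCons a (0 : Fin m → ℝ)) := by
  obtain ⟨s, hs, h⟩ := exists_sign_mul_nonneg a
  exact weaklyAlternating_cons (s := -s) (by simpa using hs) (by simp) (by linarith)

theorem WeaklyAlternating.zero_cons {m : ℕ} {u : Fin m → ℝ} (hu : WeaklyAlternating u) :
    WeaklyAlternating (Matrix.vecCons 0 u) := by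
  obtain ⟨s, hs, h⟩ := hu
  exact weaklyAlternating_cons hs h (by simp)

/-- The maximal minors of the vectors `c`, measured by the alternating form `ω`, are nonnegative and
not all zero, and `v` are the coefficients of a linear relation between the `c i`, modulo vectors
annihilated by `ω`. -/
structure NonnegRelation {E : Type*} [AddCommGroup E] [Module ℝ E] {k n : ℕ}
    (ω : E [⋀^Fin k]→ₗ[ℝ] ℝ) (c : Fin n → E) (v : Fin n → ℝ) : Prop where
  nonneg : ∀ f : Fin k → Fin n, StrictMono f → 0 ≤ ω (c ∘ f)
  exists_ne_zero : ∃ f : Fin k → Fin n, StrictMono f ∧ ω (c ∘ f) ≠ 0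
  eq_zero : ∀ w : Fin k → E, (∀ b, w b ∈ Submodule.span ℝ (Set.range c)) →
    (∃ a, w a = ∑ i, v i • c i) → ω w = 0

namespace NonnegRelation

variable {E : Type*} [AddCommGroup E] [Module ℝ E] {k n : ℕ}

theorem curryLeft {ω : E [⋀^Fin (k + 1)]→ₗ[ℝ] ℝ} {c : Fin (n + 1) → E} {v : Fin (n + 1) → ℝ}
    (H : NonnegRelation ω c v) {f : Fin k → Fin n} (hf : StrictMono f)
    (hne : ω (c ∘ Fin.cons 0 (Fin.succ ∘ f)) ≠ 0) :
    NonnegRelation (ω.curryLeft (c 0)) (c ∘ Fin.succ) (v ∘ Fin.succ) where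
  nonneg g hg := by
    have := H.nonneg _ hg.fin_cons_zero_succ
    rwa [AlternatingMap.comp_fin_cons] at this
  exists_ne_zero := ⟨f, hf, by rwa [AlternatingMap.comp_fin_cons] at hne⟩
  eq_zero := by
    rintro w hw ⟨a, ha⟩
    have hw' : ∀ b, w b ∈ Submodule.span ℝ (Set.range c) := fun b =>
      Submodule.span_mono (Set.range_comp_subset_range _ _) (hw b)
    have e : Matrix.vecCons (c 0) w =
        Function.update (Matrix.vecCons (c 0) w) a.succ (∑ i, v i • c i - v 0 • c 0) := by
      rw [eq_comm, Function.update_eq_self_iff, Fin.sum_univ_succ]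
      simp [ha]
    rw [AlternatingMap.curryLeft_apply_apply, e, ω.map_update_sub, ω.map_update_smul,
      H.eq_zero _ _ ⟨a.succ, Function.update_self ..⟩,
      ω.map_eq_zero_of_eq _ (i := 0) (j := a.succ) _ (Fin.succ_ne_zero a).symm]
    · simp
    · simp [Function.update_of_ne (Fin.succ_ne_zero a).symm]
    · intro b
      rcases eq_or_ne b a.succ with rfl | hb
      · rw [Function.update_self]
        exact Submodule.sum_mem _ fun i _ => Submodule.smul_mem _ _
          (Submodule.subset_span ⟨i, rfl⟩)
      · rw [Function.update_of_ne hb]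
        refine Fin.cases ?_ (fun b => ?_) b
        · exact Submodule.subset_span ⟨0, rfl⟩
        · exact hw' b

theorem exists_succ_ne_zero {ω : E [⋀^Fin (k + 1)]→ₗ[ℝ] ℝ} {c : Fin (n + 1) → E}
    {v : Fin (n + 1) → ℝ} (H : NonnegRelation ω c v) (hv : v 0 ≠ 0) :
    ∃ f : Fin (k + 1) → Fin n, StrictMono f ∧ ω ((c ∘ Fin.succ) ∘ f) ≠ 0 := by
  obtain ⟨f, hf, hne⟩ := H.exists_ne_zero
  obtain ⟨f', hf', rfl⟩ | ⟨f', hf', rfl⟩ := Fin.strictMono_eq_cons_or_succ hf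
  · have h0 := H.eq_zero (Matrix.vecCons (∑ i, v i • c i) (c ∘ Fin.succ ∘ f')) (by
      intro b
      refine Fin.cases ?_ (fun b => ?_) b
      · rw [Matrix.cons_val_zero]
        exact Submodule.sum_mem _ fun i _ => Submodule.smul_mem _ _
          (Submodule.subset_span ⟨i, rfl⟩)
      · exact Submodule.subset_span ⟨(f' b).succ, rfl⟩) ⟨0, rfl⟩
    have hupd : ∀ x : E, Matrix.vecCons x (c ∘ Fin.succ ∘ f') =
        Function.update (Matrix.vecCons 0 (c ∘ Fin.succ ∘ f')) 0 x := fun x =>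
      (Fin.update_cons_zero ..).symm
    rw [hupd, ω.map_update_sum, Fin.sum_univ_succ] at h0
    simp only [ω.map_update_smul] at h0
    simp only [← hupd, ← AlternatingMap.comp_fin_cons] at h0
    have : ∃ l : Fin n, ω (c ∘ Fin.cons l.succ (Fin.succ ∘ f')) ≠ 0 := by
      by_contra! hall
      simp [hall, hv, hne] at h0
    obtain ⟨l, hl⟩ := this
    have e : c ∘ Fin.cons l.succ (Fin.succ ∘ f') = (c ∘ Fin.succ) ∘ (Fin.cons l f' : _ → Fin n) := by
      ext j
      refine Fin.cases ?_ (fun j => ?_) j <;> simp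
    rw [e] at hl
    obtain ⟨g, hg, -, hg'⟩ := AlternatingMap.exists_strictMono_ne_zero ω hl
    exact ⟨g, hg, hg'⟩
  · exact ⟨f', hf', hne⟩

/-- Vanishing of all minors through `c 0` allows deleting it. -/
theorem tail_of_loop {ω : E [⋀^Fin (k + 1)]→ₗ[ℝ] ℝ} {c : Fin (n + 1) → E}
    {v : Fin (n + 1) → ℝ} (H : NonnegRelation ω c v)
    (h0 : v 0 = 0 ∨ ∀ f : Fin k → Fin n, StrictMono f → ω (c ∘ Fin.cons 0 (Fin.succ ∘ f)) = 0)
    (hne : ∃ f : Fin (k + 1) → Fin n, StrictMono f ∧ ω ((c ∘ Fin.succ) ∘ f) ≠ 0) :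
    NonnegRelation ω (c ∘ Fin.succ) (v ∘ Fin.succ) where
  nonneg f hf := H.nonneg (Fin.succ ∘ f) (Fin.strictMono_succ.comp hf)
  exists_ne_zero := hne
  eq_zero := by
    rintro w hw ⟨a, ha⟩
    have hw' : ∀ b, w b ∈ Submodule.span ℝ (Set.range c) := fun b =>
      Submodule.span_mono (Set.range_comp_subset_range _ _) (hw b)
    rcases h0 with h0 | h0
    · exact H.eq_zero w hw' ⟨a, by rw [ha, Fin.sum_univ_succ]; simp [h0]⟩
    have e : w = Function.update w a (∑ i, v i • c i - v 0 • c 0) := by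
      rw [eq_comm, Function.update_eq_self_iff, Fin.sum_univ_succ]
      simp [ha]
    have hz : ∀ r : Fin (k + 1) → Fin (n + 1), r a = 0 → ω (c ∘ r) = 0 := by
      intro r hr
      by_contra hc
      obtain ⟨f, hf, hfr, hf0⟩ := AlternatingMap.exists_strictMono_ne_zero ω hc
      obtain ⟨f', hf', rfl⟩ | ⟨f', hf', rfl⟩ := Fin.strictMono_eq_cons_or_succ hf
      · exact hf0 (h0 f' hf')
      · have : (0 : Fin (n + 1)) ∈ Set.range r := ⟨a, hr⟩
        rw [← hfr] at this
        obtain ⟨j, hj⟩ := this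
        exact Fin.succ_ne_zero _ hj
    have hcoef : ∀ b, ∃ q : Fin (n + 1) → ℝ, ∑ i, q i • c i = Function.update w a (c 0) b ∧
        (b = a → ∀ i, i ≠ 0 → q i = 0) := by
      intro b
      rcases eq_or_ne b a with rfl | hb
      · refine ⟨Pi.single 0 1, ?_, fun _ i hi => Pi.single_eq_of_ne hi _⟩
        rw [Function.update_self, Finset.sum_eq_single 0]
        · simp
        · intro i _ hi
          simp [hi]
        · simp
      · obtain ⟨q, hq⟩ := (Submodule.mem_span_range_iff_exists_fun ℝ).1 (hw' b)
        exact ⟨q, by rw [hq, Function.update_of_ne hb], fun h => absurd h hb⟩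
    choose q hq hqa using hcoef
    have hupd : ω (Function.update w a (c 0)) = 0 := by
      rw [← funext hq]
      change ω.toMultilinearMap _ = 0
      rw [MultilinearMap.map_sum]
      refine Finset.sum_eq_zero fun r _ => ?_
      rw [MultilinearMap.map_smul_univ]
      by_cases hr : r a = 0
      · exact smul_eq_zero_of_right _ (hz r hr)
      · rw [Finset.prod_eq_zero (Finset.mem_univ a) (hqa a rfl _ hr), zero_smul]
    rw [e, ω.map_update_sub, ω.map_update_smul, hupd,
      H.eq_zero _ _ ⟨a, Function.update_self ..⟩]
    · simp
    · intro b
      rcases eq_or_ne b a with rfl | hb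
      · rw [Function.update_self]
        exact Submodule.sum_mem _ fun i _ => Submodule.smul_mem _ _
          (Submodule.subset_span ⟨i, rfl⟩)
      · rw [Function.update_of_ne hb]
        exact hw' b


theorem of_span {ω : E [⋀^Fin k]→ₗ[ℝ] ℝ} {c : Fin n → E} {v : Fin n → ℝ}
    (H : NonnegRelation ω c v) {m : ℕ} {c' : Fin m → E} {v' : Fin m → ℝ}
    (hnonneg : ∀ f : Fin k → Fin m, StrictMono f → 0 ≤ ω (c' ∘ f))
    (hne : ∃ f : Fin k → Fin m, StrictMono f ∧ ω (c' ∘ f) ≠ 0)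
    (hc : ∀ i, c' i ∈ Submodule.span ℝ (Set.range c))
    (hsum : ∑ i, v' i • c' i = ∑ i, v i • c i) : NonnegRelation ω c' v' where
  nonneg := hnonneg
  exists_ne_zero := hne
  eq_zero w hw h := H.eq_zero w
    (fun b => Submodule.span_le.2 (Set.range_subset_iff.2 hc) (hw b)) (hsum ▸ h)

theorem delete_one {ω : E [⋀^Fin k]→ₗ[ℝ] ℝ} {c : Fin (n + 2) → E} {v : Fin (n + 2) → ℝ}
    (H : NonnegRelation ω c v) (h1 : v 1 = 0)
    (hne : ∃ f : Fin k → Fin (n + 1), StrictMono f ∧ ω ((c ∘ Fin.succAbove 1) ∘ f) ≠ 0) :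
    NonnegRelation ω (c ∘ Fin.succAbove 1) (v ∘ Fin.succAbove 1) :=
  H.of_span (fun _ hf => H.nonneg _ ((Fin.strictMono_succAbove 1).comp hf)) hne
    (fun i => Submodule.subset_span ⟨_, rfl⟩)
    (by rw [Fin.sum_univ_succAbove (fun i => v i • c i) 1, h1, zero_smul, zero_add]; rfl)

theorem merge {ω : E [⋀^Fin (k + 1)]→ₗ[ℝ] ℝ} {c : Fin (n + 2) → E} {v : Fin (n + 2) → ℝ}
    (H : NonnegRelation ω c v) {t : ℝ} (ht : 0 ≤ t) (htv : v 0 = v 1 * t)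
    (hne : ∃ f : Fin (k + 1) → Fin (n + 1), StrictMono f ∧ ω ((c ∘ Fin.succ) ∘ f) ≠ 0) :
    NonnegRelation ω (Matrix.vecCons (c 1 + t • c 0) (c ∘ Fin.succ ∘ Fin.succ))
      (v ∘ Fin.succ) := by
  have key : ∀ f : Fin (k + 1) → Fin (n + 1), StrictMono f → ω ((c ∘ Fin.succ) ∘ f) ≤
      ω (Matrix.vecCons (c 1 + t • c 0) (c ∘ Fin.succ ∘ Fin.succ) ∘ f) := by
    intro f hf
    obtain ⟨f', hf', rfl⟩ | ⟨f', hf', rfl⟩ := Fin.strictMono_eq_cons_or_succ hf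
    · have h0 := H.nonneg _ (Fin.strictMono_succ.comp hf').fin_cons_zero_succ
      rw [AlternatingMap.comp_fin_cons] at h0 ⊢
      rw [AlternatingMap.comp_fin_cons, Matrix.cons_val_zero, ω.map_vecCons_add,
        ω.map_vecCons_smul]
      have := mul_nonneg ht h0
      simp only [Function.comp_apply, Fin.succ_zero_eq_one, smul_eq_mul]
      exact le_add_of_nonneg_right this
    · exact le_rfl
  have hpos : ∀ f : Fin (k + 1) → Fin (n + 1), StrictMono f → 0 ≤ ω ((c ∘ Fin.succ) ∘ f) :=
    fun f hf => H.nonneg _ (Fin.strictMono_succ.comp hf)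
  refine H.of_span (fun f hf => (hpos f hf).trans (key f hf)) ?_ ?_ ?_
  · obtain ⟨f, hf, h⟩ := hne
    exact ⟨f, hf, (((hpos f hf).lt_of_ne' h).trans_le (key f hf)).ne'⟩
  · intro i
    refine Fin.cases ?_ (fun i => ?_) i
    · exact Submodule.add_mem _ (Submodule.subset_span ⟨1, rfl⟩)
        (Submodule.smul_mem _ _ (Submodule.subset_span ⟨0, rfl⟩))
    · exact Submodule.subset_span ⟨_, rfl⟩
  · rw [Fin.sum_univ_succ, Fin.sum_univ_succ (n := n + 1), Fin.sum_univ_succ (n := n)]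
    simp [htv, smul_smul]
    abel

theorem curryLeft_one {ω : E [⋀^Fin (k + 1)]→ₗ[ℝ] ℝ} {c : Fin (n + 2) → E}
    {v : Fin (n + 2) → ℝ} (H : NonnegRelation ω c v) (h1 : v 1 = 0)
    (hall : ∀ f : Fin (k + 1) → Fin (n + 1), StrictMono f →
      ω ((c ∘ Fin.succAbove 1) ∘ f) = 0) :
    NonnegRelation (ω.curryLeft (c 1)) (Matrix.vecCons (-c 0) (c ∘ Fin.succ ∘ Fin.succ))
      (Matrix.vecCons (-v 0) (v ∘ Fin.succ ∘ Fin.succ)) where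
  nonneg f hf := by
    have h2 : ∀ g : Fin k → Fin n, StrictMono g →
        0 ≤ ω (Matrix.vecCons (c 1) ((c ∘ Fin.succ ∘ Fin.succ) ∘ g)) := by
      intro g hg
      have := H.nonneg _ (Fin.strictMono_succ.comp hg.fin_cons_zero_succ)
      rwa [← Function.comp_assoc, AlternatingMap.comp_fin_cons] at this
    rw [AlternatingMap.curryLeft_apply_apply]
    cases k with
    | zero =>
      have := H.nonneg (fun _ => 1) (Fin.strictMono_of_one _)
      convert this using 2
      ext j
      rw [Fin.fin_one_eq_zero j]
      simp
    | succ k =>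
      obtain ⟨f', hf', rfl⟩ | ⟨f', hf', rfl⟩ := Fin.strictMono_eq_cons_or_succ hf
      · rw [AlternatingMap.comp_fin_cons, Matrix.cons_val_zero,
          AlternatingMap.map_vecCons_vecCons_neg]
        have := H.nonneg _ hf'.fin_cons_zero_succ.fin_cons_zero_succ
        rwa [AlternatingMap.comp_fin_cons, ← Function.comp_assoc,
          AlternatingMap.comp_fin_cons] at this
      · exact h2 f' hf'
  exists_ne_zero := by
    obtain ⟨f, hf, h⟩ := H.exists_ne_zero
    obtain ⟨f, hf', rfl⟩ | ⟨f, hf', rfl⟩ := Fin.strictMono_eq_cons_or_succ hf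
    · cases k with
      | zero =>
        refine absurd (hall (fun _ => 0) (Fin.strictMono_of_one _)) ?_
        convert h using 2
        congr 1
        ext j
        rw [Fin.fin_one_eq_zero j]
        simp
      | succ k =>
        obtain ⟨f, hg, rfl⟩ | ⟨f, hg, rfl⟩ := Fin.strictMono_eq_cons_or_succ hf'
        · refine ⟨_, hg.fin_cons_zero_succ, ?_⟩
          rw [AlternatingMap.curryLeft_apply_apply, AlternatingMap.comp_fin_cons,
            Matrix.cons_val_zero, AlternatingMap.map_vecCons_vecCons_neg]
          rwa [AlternatingMap.comp_fin_cons, ← Function.comp_assoc,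
            AlternatingMap.comp_fin_cons] at h
        · refine absurd (hall _ hg.fin_cons_zero_succ) ?_
          convert h using 2
          congr 1
          ext j
          refine Fin.cases ?_ (fun j => ?_) j <;> simp
    · obtain ⟨f, hg, rfl⟩ | ⟨f, hg, rfl⟩ := Fin.strictMono_eq_cons_or_succ hf'
      · refine ⟨_, Fin.strictMono_succ.comp hg, ?_⟩
        rwa [← Function.comp_assoc, AlternatingMap.comp_fin_cons] at h
      · refine absurd (hall _ (Fin.strictMono_succ.comp hg)) ?_
        convert h using 2
        rfl
  eq_zero := by
    rintro w hw ⟨a, ha⟩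
    refine H.eq_zero (Matrix.vecCons (c 1) w) (fun b => ?_) ⟨a.succ, ?_⟩
    · refine Fin.cases ?_ (fun b => ?_) b
      · exact Submodule.subset_span ⟨1, rfl⟩
      · refine Submodule.span_le.2 (Set.range_subset_iff.2 fun i => ?_) (hw b)
        refine Fin.cases ?_ (fun i => ?_) i
        · exact Submodule.neg_mem _ (Submodule.subset_span ⟨0, rfl⟩)
        · exact Submodule.subset_span ⟨_, rfl⟩
    · rw [Matrix.cons_val_succ, ha, Fin.sum_univ_succ, Fin.sum_univ_succ (n := n + 1),
        Fin.sum_univ_succ (n := n)]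
      simp [h1]

/-- A nontrivial relation between vectors with nonnegative maximal minors has at least `k` weak
sign changes. -/
theorem exists_weaklyAlternating {ω : E [⋀^Fin k]→ₗ[ℝ] ℝ} {c : Fin n → E}
    {v : Fin n → ℝ} (H : NonnegRelation ω c v) (hv : ∃ i, v i ≠ 0) :
    ∃ g : Fin (k + 1) → Fin n, StrictMono g ∧ WeaklyAlternating (v ∘ g) := by
  induction n generalizing k with
  | zero =>
    obtain ⟨i, _⟩ := hv
    exact i.elim0
  | succ n ih =>
    obtain ⟨i, hi⟩ := hv
    obtain _ | k := k
    · refine ⟨fun _ => 0, Fin.strictMono_of_one _, ?_⟩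
      obtain ⟨s, hs, h⟩ := exists_sign_mul_nonneg (v 0)
      exact ⟨s, hs, fun j => by simpa using h⟩
    have of_tail : ∀ g : Fin (k + 2) → Fin n, StrictMono g → WeaklyAlternating ((v ∘ Fin.succ) ∘ g) →
        ∃ g : Fin (k + 2) → Fin (n + 1), StrictMono g ∧ WeaklyAlternating (v ∘ g) :=
      fun g hg h => ⟨_, Fin.strictMono_succ.comp hg, h⟩
    have of_cons : ∀ g : Fin (k + 1) → Fin n, StrictMono g →
        WeaklyAlternating (Matrix.vecCons (v 0) ((v ∘ Fin.succ) ∘ g)) →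
        ∃ g : Fin (k + 2) → Fin (n + 1), StrictMono g ∧ WeaklyAlternating (v ∘ g) := by
      intro g hg h
      refine ⟨_, hg.fin_cons_zero_succ, ?_⟩
      rwa [AlternatingMap.comp_fin_cons]
    by_cases hv0 : v 0 = 0
    · have hi' : ∃ i, (v ∘ Fin.succ) i ≠ 0 := by
        obtain ⟨j, rfl⟩ := Fin.exists_succ_eq.2 (fun h : i = 0 => hi (h ▸ hv0))
        exact ⟨j, hi⟩
      by_cases hex : ∃ f : Fin (k + 1) → Fin n, StrictMono f ∧ ω ((c ∘ Fin.succ) ∘ f) ≠ 0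
      · obtain ⟨g, hg, h⟩ := ih (H.tail_of_loop (Or.inl hv0) hex) hi'
        exact of_tail g hg h
      · obtain ⟨f, hf, hne⟩ := H.exists_ne_zero
        obtain ⟨f', hf', rfl⟩ | ⟨f', hf', rfl⟩ := Fin.strictMono_eq_cons_or_succ hf
        · obtain ⟨g, hg, h⟩ := ih (H.curryLeft hf' hne) hi'
          exact of_cons g hg (hv0 ▸ h.zero_cons)
        · exact absurd ⟨f', hf', hne⟩ hex
    obtain ⟨f, hf, hfne⟩ := H.exists_succ_ne_zero hv0
    by_cases htail : ∃ i, (v ∘ Fin.succ) i ≠ 0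
    swap
    · push Not at htail
      refine of_cons f hf ?_
      have : (v ∘ Fin.succ) ∘ f = 0 := funext fun i => htail (f i)
      rw [this]
      exact weaklyAlternating_cons_zero _
    obtain _ | n := n
    · exact (f 0).elim0
    by_cases hv1 : v 1 = 0
    · by_cases hex : ∃ f : Fin (k + 1) → Fin (n + 1), StrictMono f ∧
          ω ((c ∘ Fin.succAbove 1) ∘ f) ≠ 0
      · obtain ⟨g, hg, h⟩ := ih (H.delete_one hv1 hex) ⟨0, by simpa using hv0⟩
        exact ⟨_, (Fin.strictMono_succAbove 1).comp hg, h⟩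
      · push Not at hex
        obtain ⟨g, hg, h⟩ := ih (H.curryLeft_one hv1 hex) ⟨0, by simpa using hv0⟩
        obtain ⟨g', hg', rfl⟩ | ⟨g', hg', rfl⟩ := Fin.strictMono_eq_cons_or_succ hg
        · obtain ⟨s, hs, h⟩ := h
          refine ⟨_, hg'.fin_cons_zero_succ.fin_cons_zero_succ, -s, by simpa using hs, fun j => ?_⟩
          refine Fin.cases ?_ (fun j => Fin.cases ?_ (fun j => ?_) j) j
          · simpa using h 0
          · simp [hv1]
          · have := h j.succ
            simpa [pow_succ] using this
        · refine of_tail _ hg'.fin_cons_zero_succ ?_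
          rw [AlternatingMap.comp_fin_cons, Function.comp_apply, Fin.succ_zero_eq_one, hv1]
          exact h.zero_cons
    rcases lt_or_gt_of_ne (mul_ne_zero hv0 hv1) with hlt | hgt
    · by_cases hl : ∀ f : Fin k → Fin (n + 1), StrictMono f →
          ω (c ∘ Fin.cons 0 (Fin.succ ∘ f)) = 0
      · obtain ⟨g, hg, h⟩ := ih (H.tail_of_loop (Or.inr hl) ⟨f, hf, hfne⟩) htail
        exact of_tail g hg h
      push Not at hl
      obtain ⟨f', hf', hf'ne⟩ := hl
      obtain ⟨g, hg, s, hs, h⟩ := ih (H.curryLeft hf' hf'ne) htail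
      rcases le_or_gt (s * v 0) 0 with hsv | hsv
      · exact of_cons g hg (weaklyAlternating_cons hs h hsv)
      have hs1 : s * v 1 < 0 := by
        by_contra! hc
        have := mul_nonneg hsv.le hc
        have e : s * v 0 * (s * v 1) = s ^ 2 * (v 0 * v 1) := by ring
        rw [e, hs] at this
        linarith
      obtain ⟨g', hg', rfl⟩ | ⟨g', hg', rfl⟩ := Fin.strictMono_eq_cons_or_succ hg
      · have := h 0
        simp at this
        linarith
      · refine of_tail _ hg'.fin_cons_zero_succ ?_
        rw [AlternatingMap.comp_fin_cons]
        exact weaklyAlternating_cons hs h hs1.le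
    · have ht : 0 ≤ v 0 / v 1 := by
        rw [← mul_div_mul_right _ _ hv1]
        exact (div_pos hgt (mul_self_pos.2 hv1)).le
      obtain ⟨g, hg, h⟩ := ih (H.merge ht (by field_simp) ⟨f, hf, hfne⟩) htail
      exact of_tail g hg h

end NonnegRelation

theorem signChanges_set_le {n : ℕ} (v : Fin n → ℝ) :
    n ∈ upperBounds {m | ∃ f : Fin (m + 1) → Fin n, StrictMono f ∧
      ∀ j : Fin m, v (f j.castSucc) * v (f j.succ) < 0} := by
  rintro m ⟨f, hf, -⟩
  have := Fintype.card_le_of_injective f hf.injective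
  simp at this
  omega

theorem varBar_set_le {n : ℕ} (v : Fin n → ℝ) :
    n ∈ upperBounds {m | ∃ w : Fin n → ℝ, (∀ i, v i ≠ 0 → w i = v i) ∧ signChanges w = m} := by
  rintro m ⟨w, -, rfl⟩
  rcases Set.eq_empty_or_nonempty {m | ∃ f : Fin (m + 1) → Fin n, StrictMono f ∧
      ∀ j : Fin m, w (f j.castSucc) * w (f j.succ) < 0} with h | h
  · rw [signChanges, h]
    simp
  · exact csSup_le h (signChanges_set_le w)

theorem le_varBar {m n : ℕ} {v : Fin n → ℝ} {g : Fin (m + 1) → Fin n} (hg : StrictMono g)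
    (h : WeaklyAlternating (v ∘ g)) : m ≤ varBar v := by
  classical
  obtain ⟨s, hs, h⟩ := h
  let w : Fin n → ℝ := fun i => if v i ≠ 0 then v i else
    ∑ j : Fin (m + 1), if g j = i then s * (-1) ^ (j : ℕ) else 0
  have hwg : ∀ j : Fin (m + 1), 0 < s * (-1) ^ (j : ℕ) * w (g j) := by
    intro j
    have hs0 : s ≠ 0 := fun h0 => by norm_num [h0] at hs
    by_cases hv : v (g j) = 0
    · have : w (g j) = s * (-1) ^ (j : ℕ) := by
        simp only [w, hv, hg.injective.eq_iff]
        simp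
      rw [this]
      exact mul_self_pos.2 (mul_ne_zero hs0 (pow_ne_zero _ (by norm_num)))
    · have : w (g j) = v (g j) := by simp [w, hv]
      rw [this]
      exact (h j).lt_of_ne' (mul_ne_zero (mul_ne_zero hs0 (pow_ne_zero _ (by norm_num))) hv)
  have hw : m ≤ signChanges w := by
    refine le_csSup ⟨n, signChanges_set_le w⟩ ⟨g, hg, fun j => ?_⟩
    have h1 := mul_pos (hwg j.castSucc) (hwg j.succ)
    have e : s * (-1) ^ (j.castSucc : ℕ) * w (g j.castSucc) *
        (s * (-1) ^ (j.succ : ℕ) * w (g j.succ)) =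
        -(s ^ 2 * ((-1) ^ 2) ^ (j : ℕ) * (w (g j.castSucc) * w (g j.succ))) := by
      simp only [Fin.val_castSucc, Fin.val_succ]
      rw [neg_one_sq, one_pow]
      have : ((-1 : ℝ) ^ (j : ℕ)) ^ 2 = 1 := by rw [← pow_mul, mul_comm, pow_mul]; simp
      linear_combination (-s ^ 2 * w (g j.castSucc) * w (g j.succ)) * this
    rw [e, hs] at h1
    simp at h1
    exact h1
  exact hw.trans (le_csSup ⟨n, varBar_set_le v⟩ ⟨w, fun i hi => by simp [w, hi], rfl⟩)

theorem exists_weaklyAlternating_of_le_varBar {m n : ℕ} (hn : 0 < n) {v : Fin n → ℝ}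
    (hm : m ≤ varBar v) :
    ∃ g : Fin (m + 1) → Fin n, StrictMono g ∧ WeaklyAlternating (v ∘ g) := by
  obtain ⟨w, hw, hwv⟩ : varBar v ∈ _ :=
    Nat.sSup_mem ⟨_, v, fun _ _ => rfl, rfl⟩ ⟨n, varBar_set_le v⟩
  obtain ⟨f, hf, hfw⟩ : signChanges w ∈ _ :=
    Nat.sSup_mem ⟨0, fun _ => ⟨0, hn⟩, fun a b h => absurd h (by omega), fun j => j.elim0⟩
      ⟨n, signChanges_set_le w⟩
  obtain ⟨s, hs, h0⟩ := exists_sign_mul_nonneg (w (f 0))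
  have hsign : ∀ j : Fin (signChanges w + 1), 0 ≤ s * (-1) ^ (j : ℕ) * w (f j) := by
    intro j
    induction j using Fin.induction with
    | zero => simpa using h0
    | succ j ih =>
      have hsq : ((-1 : ℝ) ^ (j : ℕ)) ^ 2 = 1 := by rw [← pow_mul, mul_comm, pow_mul]; simp
      have e : s * (-1) ^ (j.castSucc : ℕ) * w (f j.castSucc) *
          (s * (-1) ^ (j.succ : ℕ) * w (f j.succ)) = -(w (f j.castSucc) * w (f j.succ)) := by
        simp only [Fin.val_castSucc, Fin.val_succ]
        linear_combination (-w (f j.castSucc) * w (f j.succ)) * hs +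
          (-s ^ 2 * w (f j.castSucc) * w (f j.succ)) * hsq
      have hpos := neg_pos.2 (hfw j)
      rw [← e] at hpos
      exact (pos_of_mul_pos_right hpos ih).le
  rw [← hwv] at hm
  refine ⟨f ∘ Fin.castLE (by omega), hf.comp (Fin.strictMono_castLE _), s, hs, fun j => ?_⟩
  by_cases hv : v (f (Fin.castLE (by omega) j)) = 0
  · simp [hv]
  · have := hsign (Fin.castLE (by omega) j)
    rwa [hw _ hv] at this

theorem posMaxMinors.det_pos {n p : ℕ} {Z : Matrix (Fin n) (Fin p) ℝ} (hZ : posMaxMinors Z)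
    {g : Fin p → Fin n} (hg : StrictMono g) : 0 < (Z.submatrix g id).det := by
  have hc : (Finset.univ.map ⟨g, hg.injective⟩).card = p := by simp
  have e : g = fun t => (((Finset.univ.map ⟨g, hg.injective⟩).orderIsoOfFin hc) t).val :=
    Finset.orderEmbOfFin_unique hc (fun x => by simp) hg
  rw [e]
  exact hZ _ hc

theorem twist_eq_det_snoc {k : ℕ} (Y : Matrix (Fin k) (Fin (k + 1)) ℝ) (x : Fin (k + 1) → ℝ) :
    twist Y ![x] = Matrix.detRowAlternating (Fin.snoc (fun i => Y i) x) := by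
  rw [twist, Fin.append_right_eq_snoc]
  rfl

/-- The twistor coordinate `⟨Y x⟩` as a linear form in `x`. -/
def twistForm {k : ℕ} (Y : Matrix (Fin k) (Fin (k + 1)) ℝ) : (Fin (k + 1) → ℝ) →ₗ[ℝ] ℝ :=
  Matrix.detRowAlternating.toMultilinearMap.toLinearMap
    (Fin.snoc (fun i => Y i) 0 : Fin (k + 1) → Fin (k + 1) → ℝ) (Fin.last k)

theorem twistForm_apply {k : ℕ} (Y : Matrix (Fin k) (Fin (k + 1)) ℝ) (x : Fin (k + 1) → ℝ) :
    twistForm Y x = twist Y ![x] := by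
  rw [twist_eq_det_snoc]
  change Matrix.detRowAlternating (Function.update _ _ _) = _
  rw [Fin.update_snoc_last]

theorem twistForm_row {k : ℕ} (Y : Matrix (Fin k) (Fin (k + 1)) ℝ) (i : Fin k) :
    twistForm Y (Y i) = 0 := by
  rw [twistForm_apply, twist_eq_det_snoc]
  exact AlternatingMap.map_eq_zero_of_eq _ _ (i := i.castSucc) (j := Fin.last k) (by simp)
    (Fin.castSucc_lt_last i).ne

theorem twistForm_ne_zero {k : ℕ} {Y : Matrix (Fin k) (Fin (k + 1)) ℝ}
    (hY : LinearIndependent ℝ (fun i => Y i)) : twistForm Y ≠ 0 := by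
  intro h
  obtain ⟨x, hx⟩ : ∃ x, x ∉ Submodule.span ℝ (Set.range fun i => Y i) := by
    by_contra! hall
    have h1 := finrank_span_eq_card hY
    rw [Submodule.eq_top_iff'.2 hall, finrank_top] at h1
    simp at h1
  have hli := linearIndependent_finSnoc.2 ⟨hY, hx⟩
  have hdet := (Matrix.isUnit_iff_isUnit_det _).1 (Matrix.linearIndependent_rows_iff_isUnit.1
    (show LinearIndependent ℝ (Matrix.of (Fin.snoc (fun i => Y i) x)).row from hli))
  refine hdet.ne_zero ?_
  have := twistForm_apply Y x
  rw [h, twist_eq_det_snoc] at this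
  exact this.symm

theorem det_ne_zero_eq_zero_of_apply_eq_zero {m : ℕ} {B : Matrix (Fin m) (Fin m) ℝ}
    (hB : B.det ≠ 0) {φ : (Fin m → ℝ) →ₗ[ℝ] ℝ} (h : ∀ i, φ (B i) = 0) : φ = 0 := by
  have hli : LinearIndependent ℝ B.row :=
    Matrix.linearIndependent_rows_iff_isUnit.2 ((Matrix.isUnit_iff_isUnit_det _).2 hB.isUnit)
  have hspan := hli.span_eq_top_of_card_eq_finrank' (by simp)
  refine LinearMap.ext_on_range (v := B.row) hspan fun i => ?_
  exact h i

/-- The values of a nonzero linear form on the rows of a matrix with positive maximal minors cannot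
alternate weakly along more rows than there are columns. -/
theorem posMaxMinors.not_weaklyAlternating {n m : ℕ} {Z : Matrix (Fin n) (Fin m) ℝ}
    (hZ : posMaxMinors Z) {φ : (Fin m → ℝ) →ₗ[ℝ] ℝ} (hφ : φ ≠ 0) {g : Fin (m + 1) → Fin n}
    (hg : StrictMono g) : ¬ WeaklyAlternating (fun j => φ (Z (g j))) := by
  rintro ⟨s, hs, h⟩
  have hs0 : s ≠ 0 := fun h0 => by norm_num [h0] at hs
  let M : Matrix (Fin (m + 1)) (Fin (m + 1)) ℝ := fun j => Fin.cons (φ (Z (g j))) (Z (g j))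
  have hM : M.det = 0 := by
    rw [← Matrix.exists_mulVec_eq_zero_iff]
    refine ⟨Fin.cons (-1) fun l => φ (Pi.single l 1), ?_, ?_⟩
    · intro h0
      have := congrFun h0 0
      norm_num at this
    · ext j
      have e : φ (Z (g j)) = ∑ l, Z (g j) l * φ (Pi.single l 1) := by
        conv_lhs => rw [pi_eq_sum_univ' (Z (g j))]
        simp [map_sum]
      simp [M, Matrix.mulVec, dotProduct, Fin.sum_univ_succ, ← e]
  have hdet : ∀ j : Fin (m + 1), 0 < (Z.submatrix (g ∘ j.succAbove) id).det := fun j =>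
    hZ.det_pos (hg.comp (Fin.strictMono_succAbove j))
  rw [Matrix.det_succ_column_zero] at hM
  have hsub : ∀ j : Fin (m + 1), M.submatrix j.succAbove Fin.succ =
      Z.submatrix (g ∘ j.succAbove) id := fun j => by
    ext a b
    rfl
  have hsum : ∑ j : Fin (m + 1), s * (-1) ^ (j : ℕ) * φ (Z (g j)) *
      (Z.submatrix (g ∘ j.succAbove) id).det = 0 := by
    rw [← mul_zero s, ← hM, Finset.mul_sum]
    refine Finset.sum_congr rfl fun j _ => ?_
    rw [hsub]
    simp [M, mul_assoc]
  rw [Finset.sum_eq_zero_iff_of_nonneg fun j _ => mul_nonneg (h j) (hdet j).le] at hsum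
  have hz : ∀ j, φ (Z (g j)) = 0 := by
    intro j
    have := hsum j (Finset.mem_univ j)
    simpa [(hdet j).ne', hs0] using this
  exact hφ (det_ne_zero_eq_zero_of_apply_eq_zero (hdet 0).ne' fun i => hz _)

theorem exists_detRowAlternating_ne_zero {k n : ℕ} {C : Matrix (Fin k) (Fin n) ℝ}
    (hC : LinearIndependent ℝ (fun i => C i)) :
    ∃ f : Fin k → Fin n, StrictMono f ∧ Matrix.detRowAlternating (C.transpose ∘ f) ≠ 0 := by
  by_contra! hall
  have hall' : ∀ r : Fin k → Fin n, Matrix.detRowAlternating (C.transpose ∘ r) = 0 := by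
    intro r
    by_contra hr
    obtain ⟨f, hf, -, hne⟩ := AlternatingMap.exists_strictMono_ne_zero _ hr
    exact hne (hall f hf)
  have hspan : ∀ x : Fin k → ℝ, x ∈ Submodule.span ℝ (Set.range C.transpose) := by
    have hr : C.rank = k := by simpa using LinearIndependent.rank_matrix (M := C) hC
    rw [Matrix.rank_eq_finrank_span_cols] at hr
    have htop := Submodule.eq_top_of_finrank_eq (hr.trans (by simp))
    intro x
    have : x ∈ Submodule.span ℝ (Set.range C.col) := htop ▸ Submodule.mem_top
    exact this
  choose q hq using fun i : Fin k =>
    (Submodule.mem_span_range_iff_exists_fun ℝ).1 (hspan (Pi.single i 1))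
  have h1 : Matrix.detRowAlternating (fun i : Fin k => ∑ l, q i l • C.transpose l) = 0 := by
    change (Matrix.detRowAlternating (R := ℝ) (n := Fin k)).toMultilinearMap _ = 0
    rw [MultilinearMap.map_sum]
    refine Finset.sum_eq_zero fun r _ => ?_
    rw [MultilinearMap.map_smul_univ]
    exact smul_eq_zero_of_right _ (hall' r)
  rw [funext hq] at h1
  have h2 : (1 : Matrix (Fin k) (Fin k) ℝ).det = 0 := by
    rw [← h1]
    change _ = Matrix.det _
    congr 1
    ext i j
    simp [Matrix.one_apply, Pi.single_apply, eq_comm]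
  simp at h2

theorem detRowAlternating_transpose_comp {k n : ℕ} (C : Matrix (Fin k) (Fin n) ℝ)
    (f : Fin k → Fin n) :
    Matrix.detRowAlternating (C.transpose ∘ f) = (C.submatrix id f).det := by
  rw [← Matrix.det_transpose]
  rfl

theorem det_submatrix_nonneg_of_pluck {k n : ℕ} {C : Matrix (Fin k) (Fin n) ℝ}
    (hC : ∀ (S : Finset (Fin n)) (h : S.card = k), 0 ≤ pluck C S h)
    {f : Fin k → Fin n} (hf : StrictMono f) : 0 ≤ (C.submatrix id f).det := by
  have hc : (Finset.univ.map ⟨f, hf.injective⟩).card = k := by simp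
  have e : f = fun t => (((Finset.univ.map ⟨f, hf.injective⟩).orderIsoOfFin hc) t).val :=
    Finset.orderEmbOfFin_unique hc (fun x => by simp) hf
  rw [e]
  exact hC _ hc

theorem exists_twistForm_ne_zero {k n : ℕ} (hkn : k < n) {Z : Matrix (Fin n) (Fin (k + 1)) ℝ}
    (hZ : posMaxMinors Z) {Y : Matrix (Fin k) (Fin (k + 1)) ℝ}
    (hY : LinearIndependent ℝ (fun i => Y i)) : ∃ i, twistForm Y (Z i) ≠ 0 := by
  by_contra! hall
  have hdet := hZ.det_pos (Fin.strictMono_castLE (show k + 1 ≤ n from hkn))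
  exact twistForm_ne_zero hY (det_ne_zero_eq_zero_of_apply_eq_zero hdet.ne' fun i => hall _)

theorem varBar_eq_of_nonneg {k n : ℕ} (hkn : k < n) {Z : Matrix (Fin n) (Fin (k + 1)) ℝ}
    (hZ : posMaxMinors Z) {C : Matrix (Fin k) (Fin n) ℝ}
    (hC : LinearIndependent ℝ (fun i => C i))
    (hpos : ∀ (S : Finset (Fin n)) (h : S.card = k), 0 ≤ pluck C S h)
    {E : Matrix (Fin k) (Fin (k + 1)) ℝ} (hE : LinearIndependent ℝ (fun i => E i))
    (hspan : Submodule.span ℝ (Set.range (fun i => E i)) =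
      Submodule.span ℝ (Set.range (fun i => (C * Z) i))) :
    varBar (fun i : Fin n => twist E ![Z i]) = k := by
  simp only [← twistForm_apply]
  apply le_antisymm
  · by_contra! hlt
    obtain ⟨g, hg, h⟩ := exists_weaklyAlternating_of_le_varBar (by omega) hlt
    exact hZ.not_weaklyAlternating (twistForm_ne_zero hE) hg h
  · have hker : ∀ x ∈ Submodule.span ℝ (Set.range (fun i => E i)), twistForm E x = 0 := by
      intro x hx
      have : Submodule.span ℝ (Set.range (fun i => E i)) ≤ LinearMap.ker (twistForm E) :=
        Submodule.span_le.2 (Set.range_subset_iff.2 fun i => twistForm_row E i)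
      exact this hx
    have hsum : ∑ i, twistForm E (Z i) • C.transpose i = 0 := by
      ext j
      have h0 := hker ((C * Z) j) (hspan ▸ Submodule.subset_span ⟨j, rfl⟩)
      have e : (C * Z) j = ∑ i, C j i • Z i := by
        ext l
        simp [Matrix.mul_apply]
      rw [e, map_sum] at h0
      simpa [mul_comm] using h0
    have H : NonnegRelation (Matrix.detRowAlternating (R := ℝ) (n := Fin k)) C.transpose
        (fun i => twistForm E (Z i)) :=
      { nonneg := fun f hf => by
          rw [detRowAlternating_transpose_comp]
          exact det_submatrix_nonneg_of_pluck hpos hf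
        exists_ne_zero := exists_detRowAlternating_ne_zero hC
        eq_zero := by
          rintro w - ⟨a, ha⟩
          exact AlternatingMap.map_coord_zero _ a (ha.trans hsum) }
    obtain ⟨g, hg, h⟩ := H.exists_weaklyAlternating (exists_twistForm_ne_zero hkn hZ hE)
    exact le_varBar hg h

theorem twist_mul_row {k : ℕ} (W : Matrix (Fin k) (Fin (k + 1)) ℝ)
    (B : Matrix (Fin (k + 1)) (Fin (k + 1)) ℝ) (j : Fin (k + 1)) :
    twist (W * B) ![B j] =
      (-1) ^ (k + j : ℕ) * (W.submatrix id j.succAbove).det * B.det := by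
  have e : (Fin.snoc (fun i => (W * B) i) (B j) : Fin (k + 1) → Fin (k + 1) → ℝ) =
      Matrix.of (Fin.snoc (fun i => W i) (Pi.single j 1)) * B := by
    ext a b
    refine Fin.lastCases ?_ (fun a => ?_) a
    · simp [Matrix.mul_apply, Pi.single_apply]
    · simp [Matrix.mul_apply]
  rw [twist_eq_det_snoc, e]
  change Matrix.det _ = _
  rw [Matrix.det_mul, Matrix.det_succ_row _ (Fin.last k), Finset.sum_eq_single j]
  · have hs : (Matrix.of (Fin.snoc (fun i => W i) (Pi.single j 1) :
        Fin (k + 1) → Fin (k + 1) → ℝ)).submatrix (Fin.last k).succAbove j.succAbove =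
        W.submatrix id j.succAbove := by
      ext a b
      simp
    rw [hs]
    simp
  · intro l _ hl
    simp [hl]
  · simp

theorem StrictMono.exists_eq_succAbove {k : ℕ} {f : Fin k → Fin (k + 1)} (hf : StrictMono f) :
    ∃ j : Fin (k + 1), f = j.succAbove := by
  obtain ⟨j, hj⟩ : ∃ j, j ∉ Set.range f := by
    by_contra! hall
    have := Fintype.card_le_of_surjective f hall
    simp at this
  have hlift : ∀ i, ∃ l, j.succAbove l = f i := fun i =>
    Fin.exists_succAbove_eq fun h => hj ⟨i, h⟩
  choose p hp using hlift
  have hpm : StrictMono p := fun a b hab => by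
    have := hf hab
    rwa [← hp a, ← hp b, (Fin.strictMono_succAbove j).lt_iff_lt] at this
  have : p = id := by
    refine (hpm.range_inj strictMono_id).1 ?_
    rw [Set.range_id, (Finite.injective_iff_surjective.1 hpm.injective).range_eq]
  exact ⟨j, funext fun i => by rw [← hp i, this]; rfl⟩

theorem exists_nonneg_of_varBar_eq {k n : ℕ} (hk : 0 < k) (hkn : k < n)
    {Z : Matrix (Fin n) (Fin (k + 1)) ℝ} (hZ : posMaxMinors Z)
    {Y : Matrix (Fin k) (Fin (k + 1)) ℝ} (hY : LinearIndependent ℝ (fun i => Y i))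
    (hvar : varBar (fun i : Fin n => twist Y ![Z i]) = k) :
    ∃ C : Matrix (Fin k) (Fin n) ℝ, LinearIndependent ℝ (fun i => C i) ∧
      (∀ (S : Finset (Fin n)) (h : S.card = k), 0 ≤ pluck C S h) ∧
      Submodule.span ℝ (Set.range (fun i => Y i)) =
        Submodule.span ℝ (Set.range (fun i => (C * Z) i)) := by
  obtain ⟨g, hg, s, hs, h⟩ := exists_weaklyAlternating_of_le_varBar (by omega) hvar.ge
  have hs0 : s ≠ 0 := fun h0 => by norm_num [h0] at hs
  let B := Z.submatrix g id
  have hB : 0 < B.det := hZ.det_pos hg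
  let W := Y * B⁻¹
  have hW : W * B = Y := Matrix.nonsing_inv_mul_cancel_right _ _ hB.ne'.isUnit
  let τ : ℝˣ := Units.mk0 (s * (-1) ^ k) (mul_ne_zero hs0 (pow_ne_zero _ (by norm_num)))
  let d : Fin k → ℝˣ := Function.update 1 ⟨0, hk⟩ τ
  let D : Matrix (Fin k) (Fin k) ℝ := Matrix.diagonal fun i => (d i : ℝ)
  have hD : D.det = s * (-1) ^ k := by
    rw [Matrix.det_diagonal, ← Units.coe_prod, Finset.prod_update_of_mem (Finset.mem_univ _)]
    simp [τ]
  let G : Matrix (Fin (k + 1)) (Fin n) ℝ :=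
    Matrix.of fun j l => if g j = l then 1 else 0
  have hGZ : G * Z = B := by
    ext j l
    simp [G, B, Matrix.mul_apply]
  have hCZ : D * W * G * Z = D * Y := by
    rw [Matrix.mul_assoc _ G, hGZ, Matrix.mul_assoc, hW]
  have hrow : ∀ i, (D * W * G * Z) i = d i • Y i := by
    intro i
    rw [hCZ]
    ext l
    simp [D, Matrix.diagonal_mul, Units.smul_def]
  have hli : LinearIndependent ℝ (fun i => (D * W * G * Z) i) := by
    rw [funext hrow]
    exact hY.units_smul d
  refine ⟨D * W * G, LinearIndependent.of_comp (Matrix.vecMulLinear Z) hli, fun S hS => ?_, ?_⟩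
  · set f : Fin k → Fin n := fun t => ((S.orderIsoOfFin hS) t).val
    have hf : StrictMono f := (S.orderEmbOfFin hS).strictMono
    change 0 ≤ ((D * W * G).submatrix id f).det
    have e : (D * W * G).submatrix id f = D * (W * G.submatrix id f) := by
      rw [Matrix.mul_assoc]
      rfl
    rw [e, Matrix.det_mul, hD]
    by_cases hr : ∀ t, ∃ j, g j = f t
    · choose p hp using hr
      have hpm : StrictMono p := fun a b hab => by
        have := hf hab
        rwa [← hp a, ← hp b, hg.lt_iff_lt] at this
      obtain ⟨j, rfl⟩ := hpm.exists_eq_succAbove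
      have hsub : W * G.submatrix id f = W.submatrix id j.succAbove := by
        ext a b
        simp [Matrix.mul_apply, G, ← hp, hg.injective.eq_iff]
      have hj := h j
      have ht : twist Y ![Z (g j)] =
          (-1) ^ (k + j : ℕ) * (W.submatrix id j.succAbove).det * B.det := by
        rw [← twist_mul_row, hW]
        rfl
      simp only [Function.comp_apply, ht] at hj
      rw [hsub]
      have hsq : ((-1 : ℝ) ^ (j : ℕ)) ^ 2 = 1 := by rw [← pow_mul, mul_comm, pow_mul]; simp
      have hj' : 0 ≤ (s * (-1) ^ k * (W.submatrix id j.succAbove).det) * B.det := by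
        refine hj.trans_eq ?_
        rw [pow_add]
        linear_combination (s * (-1) ^ k * (W.submatrix id j.succAbove).det * B.det) * hsq
      exact nonneg_of_mul_nonneg_left hj' hB
    · push Not at hr
      obtain ⟨t, ht⟩ := hr
      rw [Matrix.det_eq_zero_of_column_eq_zero t]
      · simp
      · intro i
        simp [Matrix.mul_apply, G, ht]
  · rw [funext hrow]
    apply le_antisymm <;> refine Submodule.span_le.2 (Set.range_subset_iff.2 fun i => ?_)
    · have : (d i : ℝ)⁻¹ • (d i • Y i) ∈ Submodule.span ℝ (Set.range fun i => d i • Y i) :=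
        Submodule.smul_mem _ _ (Submodule.subset_span ⟨i, rfl⟩)
      simpa [Units.smul_def, smul_smul] using this
    · exact Submodule.smul_mem _ (d i : ℝ) (Submodule.subset_span ⟨i, rfl⟩)

/-- The `m = 1` amplituhedron is exactly the locus where the twistor vector
has `var-bar` equal to `k`. -/
theorem stmt8 (k n : ℕ) (hk : 0 < k) (hkn : k < n)
    (Z : Matrix (Fin n) (Fin (k + 1)) ℝ) (hZ : posMaxMinors Z)
    (A : Set (Gr k (k + 1)))
    (hA : A = {P | ∃ (C : Matrix (Fin k) (Fin n) ℝ)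
        (hC : LinearIndependent ℝ (fun i => C i)),
        (∀ (S : Finset (Fin n)) (h : S.card = k), 0 ≤ pluck C S h) ∧
        ∃ (E : Matrix (Fin k) (Fin (k + 1)) ℝ)
          (hE : LinearIndependent ℝ (fun i => E i)),
          grMk E hE = P ∧
          Submodule.span ℝ (Set.range (fun i => E i)) =
            Submodule.span ℝ (Set.range (fun i => (C * Z) i))}) :
    A = {P : Gr k (k + 1) |
      ∃ (Y : Matrix (Fin k) (Fin (k + 1)) ℝ)
        (hY : LinearIndependent ℝ (fun i => Y i)),
        grMk Y hY = P ∧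
        varBar (fun i : Fin n => twist Y ![Z i]) = k} := by
  subst hA
  ext P
  constructor
  · rintro ⟨C, hC, hpos, E, hE, hP, hspan⟩
    exact ⟨E, hE, hP, varBar_eq_of_nonneg hkn hZ hC hpos hE hspan⟩
  · rintro ⟨Y, hY, hP, hvar⟩
    obtain ⟨C, hC, hpos, hspan⟩ := exists_nonneg_of_varBar_eq hk hkn hZ hY hvar
    exact ⟨C, hC, hpos, Y, hY, hP, hspan⟩
end
end

section
/- Let k, m ≥ 1 with k + m ≤ n, let Z ∈ Mat^{>0}_{n,k+m} with rows Z_1,…,Z_n, set Ẑ_1 := (−1)^{k+m−1} Z_1 and r := ⌊m/2⌋. Let Y = Z̃(C) for a totally positive point C ∈ Gr>0_{k,n} (with any fixed rank-k matrix representative, so the twistor coordinates of Y are defined without sign ambiguity). If m is even, then: ⟨Y Z_I⟩ > 0 for every I = {i_1, i_1+1, i_2, i_2+1, …, i_r, i_r+1} ⊆ [n] that is a disjoint union of r pairs of consecutive integers; and ⟨Y Z_I Z_n Ẑ_1⟩ > 0 (twistor coordinate with rows Z_i for i ∈ I in increasing order, followed by Z_n and Ẑ_1) for every I ⊆ {2,…,n−1}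 that is a disjoint union of r−1 pairs of consecutive integers. If m is odd, then: (−1)^k ⟨Y Z_I⟩ > 0 for every I = {1, i_1, i_1+1, …, i_r, i_r+1} ⊆ [n] with 1 < i_1 which is {1} together with a disjoint union of r pairs of consecutive integers; and ⟨Y Z_I⟩ > 0 for every I = {i_1, i_1+1, …, i_r, i_r+1, n} ⊆ [n] with i_r+1 < n which is a disjoint union of r pairs of consecutive integers together with {n}. -/
noncomputable section

/-- The sign of the permutation sorting an injective sequence `w`, as a product over inversions. -/
def sortSign {p n : ℕ} (w : Fin p → Fin n) : ℝ :=
  ∏ j, ∏ i, if i < j then (if w i < w j then 1 else -1) else 1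

lemma sortSign_mul_self {p n : ℕ} (w : Fin p → Fin n) : sortSign w * sortSign w = 1 := by
  simp only [sortSign, ← Finset.prod_mul_distrib]
  refine Finset.prod_eq_one fun j _ => Finset.prod_eq_one fun i _ => ?_
  split_ifs <;> norm_num

lemma sortSign_perm {p : ℕ} (σ : Equiv.Perm (Fin p)) :
    sortSign σ = ((Equiv.Perm.sign σ : ℤ) : ℝ) := by
  rw [Equiv.Perm.sign_eq_prod_prod_Iio]
  simp only [sortSign]
  push_cast
  refine Finset.prod_congr rfl fun j _ => ?_
  rw [← Finset.prod_filter]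
  refine Finset.prod_congr (by ext; simp) fun i _ => ?_
  split_ifs <;> simp

lemma sortSign_of_strictMono {p n : ℕ} {w : Fin p → Fin n} (hw : StrictMono w) :
    sortSign w = 1 := by
  refine Finset.prod_eq_one fun j _ => Finset.prod_eq_one fun i _ => ?_
  split_ifs with h h'
  · rfl
  · exact absurd (hw h) h'
  · rfl

lemma sortSign_strictMono_comp {p q n : ℕ} {e : Fin q → Fin n} (he : StrictMono e)
    (w : Fin p → Fin q) : sortSign (e ∘ w) = sortSign w := by
  simp only [sortSign, Function.comp, he.lt_iff_lt]

lemma exists_perm_comp_eq {p n : ℕ} {w : Fin p → Fin n} (hw : Function.Injective w)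
    (h : (Finset.univ.image w).card = p) :
    ∃ σ : Equiv.Perm (Fin p),
      w = (fun t => (((Finset.univ.image w).orderIsoOfFin h) t).val) ∘ σ := by
  let e := (Finset.univ.image w).orderIsoOfFin h
  let s : Fin p → Fin p := fun i => e.symm ⟨w i, by simp⟩
  have hs : Function.Injective s := fun a b hab => hw (by simpa [s] using hab)
  refine ⟨Equiv.ofBijective s (Finite.injective_iff_bijective.mp hs), ?_⟩
  funext i
  exact (congrArg Subtype.val (e.apply_symm_apply ⟨w i, by simp⟩)).symm

lemma sortSign_mul_det_pos {p n : ℕ} {A : Matrix (Fin n) (Fin p) ℝ} (hA : posMaxMinors A)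
    {w : Fin p → Fin n} (hw : Function.Injective w) :
    0 < sortSign w * (A.submatrix w id).det := by
  have h : (Finset.univ.image w).card = p := by
    simp [Finset.card_image_of_injective _ hw]
  obtain ⟨σ, hσ⟩ := exists_perm_comp_eq hw h
  have hpos := hA _ h
  set e := fun t => (((Finset.univ.image w).orderIsoOfFin h) t).val
  have he : StrictMono e := ((Finset.univ.image w).orderIsoOfFin h).strictMono
  have hdet : (A.submatrix w id).det = sortSign σ * (A.submatrix e id).det := by
    rw [sortSign_perm, ← Matrix.det_permute, Matrix.submatrix_submatrix, hσ]
    rfl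
  have hsign : sortSign w = sortSign σ := by
    rw [hσ]
    exact sortSign_strictMono_comp he _
  rw [hdet, hsign, ← mul_assoc, sortSign_mul_self, one_mul]
  exact hpos

/-- The sign of moving `c` past all entries of `u` into sorted position. -/
def passSign {m n : ℕ} (c : Fin n) (u : Fin m → Fin n) : ℝ :=
  ∏ b, if c < u b then 1 else -1

lemma sortSign_append {k m n : ℕ} (f : Fin k → Fin n) (u : Fin m → Fin n) :
    sortSign (Fin.append f u) = sortSign f * ((∏ a, passSign (f a) u) * sortSign u) := by
  have hlt (a : Fin k) (b : Fin m) : Fin.castAdd m a < Fin.natAdd k b := by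
    rw [Fin.lt_def]; simp; omega
  simp only [sortSign, passSign, Fin.prod_univ_add, Fin.append_left, Fin.append_right,
    (Fin.strictMono_castAdd m).lt_iff_lt, (Fin.strictMono_natAdd k).lt_iff_lt, hlt, (hlt _ _).not_gt, if_true, if_false,
    Finset.prod_const_one, Finset.prod_mul_distrib]
  rw [Finset.prod_comm (f := fun b a => if f a < u b then (1 : ℝ) else -1)]
  ring

/-- A symmetrized form of the Cauchy-Binet expansion. -/
lemma factorial_mul_alternating_eq_sum {k n : ℕ} {M : Type*} [AddCommGroup M] [Module ℝ M]
    (φ : M [⋀^Fin k]→ₗ[ℝ] ℝ) (C : Matrix (Fin k) (Fin n) ℝ) (v : Fin n → M) :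
    (k.factorial : ℝ) * φ (fun i => ∑ a, C i a • v a)
      = ∑ f : Fin k → Fin n, (C.submatrix id f).det * φ (v ∘ f) := by
  have hexp : φ (fun i => ∑ a, C i a • v a)
      = ∑ f : Fin k → Fin n, (∏ i, C i (f i)) * φ (v ∘ f) := by
    have := φ.toMultilinearMap.map_sum (fun i (a : Fin n) => C i a • v a)
    simp only [MultilinearMap.map_smul_univ] at this
    exact this
  have hperm (σ : Equiv.Perm (Fin k)) : φ (fun i => ∑ a, C i a • v a)
      = ∑ f : Fin k → Fin n,
        ((Equiv.Perm.sign σ : ℤ) : ℝ) * (∏ i, C i (f (σ i))) * φ (v ∘ f) := by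
    rw [hexp, ← (Equiv.arrowCongr σ (Equiv.refl (Fin n))).symm.sum_comp]
    refine Finset.sum_congr rfl fun f _ => ?_
    have := φ.map_perm (v ∘ f) σ
    rw [show (v ∘ (Equiv.arrowCongr σ (Equiv.refl (Fin n))).symm f) = (v ∘ f) ∘ σ from rfl, this,
      Units.smul_def, zsmul_eq_mul]
    simp only [Equiv.arrowCongr_symm, Equiv.arrowCongr_apply, Function.comp]
    simp
    ring
  calc (k.factorial : ℝ) * φ (fun i => ∑ a, C i a • v a)
      = ∑ _σ : Equiv.Perm (Fin k), φ (fun i => ∑ a, C i a • v a) := by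
        simp [Finset.card_univ, Fintype.card_perm]
    _ = _ := by
        rw [Finset.sum_congr rfl fun σ _ => hperm σ, Finset.sum_comm]
        refine Finset.sum_congr rfl fun f _ => ?_
        rw [← Finset.sum_mul, ← Matrix.det_transpose, Matrix.det_apply']
        rfl

lemma of_append_update {k m : ℕ} {α : Type*} [DecidableEq (Fin k)]
    (y : Fin k → Fin (k + m) → α)
    (u : Fin m → Fin (k + m) → α) (i : Fin k) (c : Fin (k + m) → α) :
    Matrix.of (Fin.append (fun j => Matrix.of (Function.update y i c) j) u)
      = (Matrix.of (Fin.append y u)).updateRow (Fin.castAdd m i) c := by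
  ext a b
  refine Fin.addCases (fun a => ?_) (fun a => ?_) a
  · by_cases h : a = i
    · simp [h]
    · simp [h, Matrix.updateRow_apply]
  · have : Fin.natAdd k a ≠ Fin.castAdd m i := fun h => by
      have := congrArg Fin.val h
      simp at this
      omega
    simp [this, Matrix.updateRow_apply]

/-- `twist` as an alternating function of the first `k` rows. -/
def twistAlternating {k m : ℕ} (u : Fin m → Fin (k + m) → ℝ) :
    (Fin (k + m) → ℝ) [⋀^Fin k]→ₗ[ℝ] ℝ where
  toFun y := twist (Matrix.of y) u
  map_update_add' y i a b := by
    simpa only [twist, of_append_update] using Matrix.det_updateRow_add _ _ _ _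
  map_update_smul' y i c a := by
    simpa only [twist, of_append_update, smul_eq_mul] using Matrix.det_updateRow_smul _ _ _ _
  map_eq_zero_of_eq' y i j hij hne := by
    refine Matrix.det_zero_of_row_eq (i := Fin.castAdd m i) (j := Fin.castAdd m j) ?_ ?_
    · simpa using hne
    · funext t
      simp [hij]

lemma twist_smul {k m : ℕ} (Y : Matrix (Fin k) (Fin (k + m)) ℝ) (d : Fin m → ℝ)
    (u : Fin m → Fin (k + m) → ℝ) :
    twist Y (fun j => d j • u j) = (∏ j, d j) * twist Y u := by
  have := Matrix.det_mul_column (Fin.append (fun _ : Fin k => (1 : ℝ)) d)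
    (Matrix.of (Fin.append (fun i => Y i) u))
  rw [Fin.prod_univ_add] at this
  simp only [Fin.append_left, Fin.append_right, Finset.prod_const_one, one_mul] at this
  rw [twist, twist, ← this]
  congr 1
  ext i j
  refine Fin.addCases (fun i => ?_) (fun i => ?_) i <;> simp

lemma sortSign_mul_twist_pos {k m n : ℕ} (hkm : k + m ≤ n)
    {Z : Matrix (Fin n) (Fin (k + m)) ℝ} (hZ : posMaxMinors Z)
    {C : Matrix (Fin k) (Fin n) ℝ}
    (hC : ∀ (S : Finset (Fin n)) (h : S.card = k), 0 < pluck C S h)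
    {u : Fin m → Fin n} (hu : Function.Injective u) {δ : ℝ}
    (hδ : ∀ c ∉ Set.range u, passSign c u = δ) :
    0 < sortSign u * δ ^ k * twist (C * Z) (fun j => Z (u j)) := by
  have hCt : posMaxMinors C.transpose := fun S h => by
    have := hC S h
    rw [pluck, ← Matrix.det_transpose] at this
    exact this
  let φ := twistAlternating (k := k) (fun j => Z (u j))
  have hφ (f : Fin k → Fin n) : φ (Z ∘ f) = (Z.submatrix (Fin.append f u) id).det := by
    refine congrArg Matrix.det ?_
    ext i j
    refine Fin.addCases (fun i => ?_) (fun i => ?_) i <;> simp [Function.comp_apply (f := Z)]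
  have htwist : twist (C * Z) (fun j => Z (u j)) = φ (fun i => ∑ a, C i a • Z a) := by
    refine congrArg (fun y => twist y _) ?_
    ext i j
    simp [Matrix.mul_apply]
  have hsum := factorial_mul_alternating_eq_sum φ C Z
  rw [← htwist] at hsum
  have hpos (f : Fin k → Fin n) (hf : Function.Injective (Fin.append f u)) :
      0 < sortSign u * δ ^ k * ((C.submatrix id f).det * φ (Z ∘ f)) := by
    have hfi : Function.Injective f := fun a b hab => by
      have := @hf (Fin.castAdd m a) (Fin.castAdd m b) (by simpa using hab)
      simpa using this
    have hfu (a) : f a ∉ Set.range u := by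
      rintro ⟨b, hb⟩
      have := @hf (Fin.castAdd m a) (Fin.natAdd k b) (by simpa using hb.symm)
      have := congrArg Fin.val this
      simp at this
      omega
    have h1 := sortSign_mul_det_pos hCt hfi
    have h2 := sortSign_mul_det_pos hZ hf
    rw [sortSign_append, Finset.prod_congr rfl fun a _ => hδ _ (hfu a), ← hφ] at h2
    rw [← Matrix.transpose_submatrix, Matrix.det_transpose] at h1
    have h3 := mul_pos h1 h2
    have h4 := sortSign_mul_self f
    simp only [Finset.prod_const, Finset.card_univ, Fintype.card_fin] at h3
    calc (0 : ℝ) < _ := h3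
      _ = (sortSign f * sortSign f) *
          (sortSign u * δ ^ k * ((C.submatrix id f).det * φ (Z ∘ f))) := by ring
      _ = _ := by rw [h4, one_mul]
  have hnonneg (f : Fin k → Fin n) :
      0 ≤ sortSign u * δ ^ k * ((C.submatrix id f).det * φ (Z ∘ f)) := by
    by_cases hf : Function.Injective (Fin.append f u)
    · exact (hpos f hf).le
    · obtain ⟨i, j, hij, hne⟩ := Function.not_injective_iff.mp hf
      have h0 : φ (Z ∘ f) = 0 := by
        rw [hφ]
        exact Matrix.det_zero_of_row_eq hne (by funext t; simp [hij])
      simp [h0]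
  obtain ⟨f, hf⟩ : ∃ f : Fin k → Fin n, Function.Injective (Fin.append f u) := by
    have hcard : k ≤ (Finset.univ.image u)ᶜ.card := by
      rw [Finset.card_compl, Finset.card_image_of_injective _ hu]
      simp
      omega
    obtain ⟨S, hS, hSk⟩ := Finset.exists_subset_card_eq hcard
    refine ⟨S.orderEmbOfFin hSk, Fin.append_injective_iff.mpr ⟨?_, hu, ?_⟩⟩
    · exact (S.orderEmbOfFin hSk).injective
    · intro a b hab
      have := hS (S.orderEmbOfFin_mem hSk a)
      simp [hab] at this
  have htotal : 0 < (k.factorial : ℝ) *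
      (sortSign u * δ ^ k * twist (C * Z) (fun j => Z (u j))) := by
    rw [mul_left_comm, hsum, Finset.mul_sum]
    exact Finset.sum_pos' (fun f _ => hnonneg f) ⟨f, Finset.mem_univ _, hpos f hf⟩
  exact pos_of_mul_pos_right htotal (by positivity)

lemma passSign_eq_one_of_pairs {m n r : ℕ} (hm : m = 2 * r) {u : Fin m → Fin n}
    (hu : ∀ t : Fin r, (u ⟨2 * t.val + 1, by omega⟩).val = (u ⟨2 * t.val, by omega⟩).val + 1)
    {c : Fin n} (hc : c ∉ Set.range u) : passSign c u = 1 := by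
  subst hm
  rw [passSign, ← (finProdFinEquiv.trans (finCongr (Nat.mul_comm r 2))).prod_comp,
    Fintype.prod_prod_type]
  refine Finset.prod_eq_one fun t _ => ?_
  rw [Fin.prod_univ_two]
  have h0 : (finProdFinEquiv.trans (finCongr (Nat.mul_comm r 2))) (t, 0)
      = ⟨2 * t.val, by omega⟩ := by ext; simp
  have h1 : (finProdFinEquiv.trans (finCongr (Nat.mul_comm r 2))) (t, 1)
      = ⟨2 * t.val + 1, by omega⟩ := by ext; simp; omega
  rw [h0, h1]
  have hne : c.val ≠ (u ⟨2 * t.val + 1, by omega⟩).val :=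
    fun h => hc ⟨_, (Fin.ext h).symm⟩
  have := hu t
  have hne0 : c.val ≠ (u ⟨2 * t.val, by omega⟩).val :=
    fun h => hc ⟨_, (Fin.ext h).symm⟩
  simp only [Fin.lt_def]
  split_ifs <;> first | omega | norm_num

lemma passSign_succ {m n : ℕ} (c : Fin n) (u : Fin (m + 1) → Fin n) :
    passSign c u = (if c < u 0 then 1 else -1) * passSign c (fun j => u j.succ) :=
  Fin.prod_univ_succ _

lemma passSign_castSucc {m n : ℕ} (c : Fin n) (u : Fin (m + 1) → Fin n) :
    passSign c u = passSign c (fun j => u j.castSucc) * (if c < u (Fin.last m) then 1 else -1) :=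
  Fin.prod_univ_castSucc _

lemma sortSign_castSucc {m n : ℕ} (u : Fin (m + 1) → Fin n) :
    sortSign u = sortSign (fun j => u j.castSucc) *
      ∏ i : Fin m, if u i.castSucc < u (Fin.last m) then 1 else -1 := by
  simp only [sortSign, Fin.prod_univ_castSucc, Fin.castSucc_lt_castSucc_iff, Fin.castSucc_lt_last,
    lt_irrefl, (Fin.castSucc_lt_last _).not_gt, if_true, if_false, mul_one]

/-- Sign conditions satisfied by the twistor coordinates of `Y = C Z` for a
totally positive point `C` (represented by a matrix with positive Pluecker
coordinates): the twistor coordinates indexed by unions of consecutive pairs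
(together with `1` or `n` and the twisted row, as dictated by the parity of
`m`) have fixed signs. -/
theorem stmt9 (k m n : ℕ) (hk : 1 ≤ k) (hm : 1 ≤ m) (hkm : k + m ≤ n)
    (Z : Matrix (Fin n) (Fin (k + m)) ℝ) (hZ : posMaxMinors Z)
    (C : Matrix (Fin k) (Fin n) ℝ)
    (hC : LinearIndependent ℝ (fun i => C i))
    (hCpos : ∀ (S : Finset (Fin n)) (h : S.card = k), 0 < pluck C S h) :

        (∀ _hme : m % 2 = 0,
          (∀ g : Fin m → Fin n, StrictMono g →
            (∀ t : Fin (m / 2),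
              (g ⟨2 * t.val + 1, by have := t.isLt; omega⟩).val
                = (g ⟨2 * t.val, by have := t.isLt; omega⟩).val + 1) →
            0 < twist (C * Z) (fun j => Z (g j))) ∧
          (∀ g : Fin (m - 2) → Fin n, StrictMono g →
            (∀ t : Fin (m / 2 - 1),
              (g ⟨2 * t.val + 1, by have := t.isLt; omega⟩).val
                = (g ⟨2 * t.val, by have := t.isLt; omega⟩).val + 1) →
            (∀ t : Fin (m - 2), 1 ≤ (g t).val ∧ (g t).val ≤ n - 2) →
            0 < twist (C * Z) (fun j =>
              if hj : j.val < m - 2 then Z (g ⟨j.val, hj⟩)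
              else if j.val = m - 2 then Z ⟨n - 1, by omega⟩
              else ((-1 : ℝ) ^ (k + m - 1)) • Z ⟨0, by omega⟩))) ∧
        (∀ _hmo : m % 2 = 1,
          (∀ g : Fin m → Fin n, StrictMono g →
            (g ⟨0, by omega⟩).val = 0 →
            (∀ t : Fin (m / 2),
              (g ⟨2 * t.val + 2, by have := t.isLt; omega⟩).val
                = (g ⟨2 * t.val + 1, by have := t.isLt; omega⟩).val + 1) →
            0 < (-1 : ℝ) ^ k * twist (C * Z) (fun j => Z (g j))) ∧
          (∀ g : Fin m → Fin n, StrictMono g →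
            (g ⟨m - 1, by omega⟩).val = n - 1 →
            (∀ t : Fin (m / 2),
              (g ⟨2 * t.val + 1, by have := t.isLt; omega⟩).val
                = (g ⟨2 * t.val, by have := t.isLt; omega⟩).val + 1) →
            0 < twist (C * Z) (fun j => Z (g j)))) := by
  refine ⟨fun hme => ⟨fun g hg hpair => ?_, fun g hg hpair hrange => ?_⟩,
    fun hmo => ⟨fun g hg hfirst hpair => ?_, fun g hg hlast hpair => ?_⟩⟩
  · have h := sortSign_mul_twist_pos hkm hZ hCpos hg.injective
      fun c hc => passSign_eq_one_of_pairs (by omega) hpair hc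
    simpa [sortSign_of_strictMono hg] using h
  · obtain ⟨q, rfl⟩ : ∃ q, m = q + 2 := ⟨m - 2, by omega⟩
    let v : Fin (q + 1) → Fin n := Fin.snoc (α := fun _ => Fin n) g ⟨n - 1, by omega⟩
    let u : Fin (q + 2) → Fin n := Fin.snoc (α := fun _ => Fin n) v ⟨0, by omega⟩
    have hgr (t : Fin q) : 1 ≤ (g t).val ∧ (g t).val ≤ n - 2 := hrange t
    have hv : StrictMono v := by
      intro a b hab
      induction b using Fin.lastCases with
      | last =>
        induction a using Fin.lastCases with
        | last => exact absurd hab (lt_irrefl _)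
        | cast a =>
          have := hgr a
          simp only [v, Fin.snoc_castSucc, Fin.snoc_last, Fin.lt_def]
          omega
      | cast b =>
        induction a using Fin.lastCases with
        | last => exact absurd hab (Fin.castSucc_lt_last b).not_gt
        | cast a =>
          simp only [v, Fin.snoc_castSucc]
          exact hg (by simpa using hab)
    have hvpos (a : Fin (q + 1)) : 0 < (v a).val := by
      induction a using Fin.lastCases with
      | last => simp only [v, Fin.snoc_last]; omega
      | cast a => simp only [v, Fin.snoc_castSucc]; exact (hgr a).1
    have hu : Function.Injective u := by
      refine Fin.snoc_injective_iff.mpr ⟨hv.injective, ?_⟩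
      rintro ⟨a, ha⟩
      have := hvpos a
      simp [ha] at this
    have hsign : sortSign u = (-1) ^ (q + 1) := by
      rw [sortSign_castSucc]
      simp only [u, Fin.snoc_castSucc, Fin.snoc_last]
      rw [show sortSign (fun j => v j) = 1 from sortSign_of_strictMono hv, one_mul,
        Finset.prod_congr rfl fun i _ => if_neg ?_]
      · simp
      · simp [Fin.lt_def]
    have h := sortSign_mul_twist_pos hkm hZ hCpos hu (δ := -1) fun c hc => by
      have hcv (a) : c ≠ v a := fun h => hc ⟨a.castSucc, by simp [u, h]⟩
      have hcg : c ∉ Set.range g := by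
        rintro ⟨a, rfl⟩
        exact hcv a.castSucc (by simp [v])
      have hcn : c.val ≠ n - 1 := fun h => hcv (Fin.last q) (by simp [v, Fin.ext_iff, h])
      have hlt : c < ⟨n - 1, by omega⟩ := by rw [Fin.lt_def]; simp; omega
      rw [passSign_castSucc, passSign_castSucc]
      simp only [u, v, Fin.snoc_castSucc, Fin.snoc_last]
      rw [passSign_eq_one_of_pairs (r := (q + 2) / 2 - 1) (by omega) hpair hcg, if_pos hlt,
        if_neg (by simp [Fin.lt_def])]
      norm_num
    let d : Fin (q + 2) → ℝ :=
      Fin.snoc (α := fun _ => ℝ) (fun _ => 1) ((-1) ^ (k + (q + 2) - 1))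
    have hrows : (fun j : Fin (q + 2) =>
        if hj : j.val < q + 2 - 2 then Z (g ⟨j.val, hj⟩)
        else if j.val = q + 2 - 2 then Z ⟨n - 1, by omega⟩
        else ((-1 : ℝ) ^ (k + (q + 2) - 1)) • Z ⟨0, by omega⟩)
        = fun j => d j • Z (u j) := by
      funext j
      induction j using Fin.lastCases with
      | last => simp [d, u]
      | cast j =>
        induction j using Fin.lastCases with
        | last => simp [d, u, v]
        | cast j => simp [d, u, v]
    rw [hrows, twist_smul]
    rw [hsign] at h
    have hd : ∏ j, d j = (-1) ^ (q + 1) * (-1) ^ k := by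
      simp only [d, Fin.prod_univ_castSucc, Fin.snoc_castSucc, Fin.snoc_last]
      rw [← pow_add]
      simp
      congr 1
      omega
    rw [hd]
    exact h
  · obtain ⟨q, rfl⟩ : ∃ q, m = q + 1 := ⟨m - 1, by omega⟩
    have h := sortSign_mul_twist_pos hkm hZ hCpos hg.injective (δ := -1) fun c hc => by
      have h0 : ¬ c < g 0 := by
        have : (g 0).val = 0 := hfirst
        simp [Fin.lt_def, this]
      rw [passSign_succ, if_neg h0, passSign_eq_one_of_pairs (r := (q + 1) / 2) (by omega)
        (fun t => hpair t) (fun ⟨a, ha⟩ => hc ⟨_, ha⟩), mul_one]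
    simpa [sortSign_of_strictMono hg] using h
  · obtain ⟨q, rfl⟩ : ∃ q, m = q + 1 := ⟨m - 1, by omega⟩
    have h := sortSign_mul_twist_pos hkm hZ hCpos hg.injective (δ := 1) fun c hc => by
      have h0 : c < g (Fin.last q) := by
        have h1 : (g (Fin.last q)).val = n - 1 := hlast
        have h2 : c.val ≠ (g (Fin.last q)).val := fun h => hc ⟨_, (Fin.ext h).symm⟩
        rw [Fin.lt_def]
        omega
      rw [passSign_castSucc, if_pos h0, mul_one]
      exact passSign_eq_one_of_pairs (m := q) (r := (q + 1) / 2) (by omega) (fun t => hpair t)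
        (fun ⟨a, ha⟩ => hc ⟨_, ha⟩)
    simpa [sortSign_of_strictMono hg] using h
end
end
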